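/- arXiv:1606.00963 — 2 statements merged into one kernel-verified Lean document; each statement's English description precedes it below -/
import Mathlib

section
/- Every optimal set of three-means for P equals {(1/8, √3/16), (7/8, √3/16), (1/2, 3√3/8)}, and the third quantization error is V₃(P) = 189/7040. -/
open MeasureTheory Real Set
open scoped ENNReal NNReal

/-- The three contractive similarities generating the nonhomogeneous R-triangle.
Letters 1,2,3 of the paper correspond to `0,1,2 : Fin 3`. -/
noncomputable def Smap : Fin 3 → ℝ × ℝ → ℝ × ℝ :=
  ![fun x => (x.1 / 4, x.2 / 4),
    fun x => (x.1 / 4 + 3 / 4, x.2 / 4),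
    fun x => (x.1 / 2 + 1 / 4, x.2 / 2 + Real.sqrt 3 / 4)]

/-- `Sw ω = S_{ω₁} ∘ ⋯ ∘ S_{ω_k}` for a word `ω = ω₁⋯ω_k`. -/
noncomputable def Sw (ω : List (Fin 3)) : ℝ × ℝ → ℝ × ℝ :=
  (ω.map Smap).foldr (· ∘ ·) id

/-- The probability weights `p₁ = p₂ = 1/5`, `p₃ = 3/5`. -/
noncomputable def pr : Fin 3 → ℝ := ![1/5, 1/5, 3/5]

/-- The similarity ratios `s₁ = s₂ = 1/4`, `s₃ = 1/2`. -/
noncomputable def sr : Fin 3 → ℝ := ![1/4, 1/4, 1/2]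

/-- `p_ω = p_{ω₁}⋯p_{ω_k}`. -/
noncomputable def pw (ω : List (Fin 3)) : ℝ := (ω.map pr).prod

/-- `s_ω = s_{ω₁}⋯s_{ω_k}`. -/
noncomputable def sw (ω : List (Fin 3)) : ℝ := (ω.map sr).prod

/-- `P` is the nonhomogeneous R-measure:
`P = (1/5)·P∘S₁⁻¹ + (1/5)·P∘S₂⁻¹ + (3/5)·P∘S₃⁻¹`. -/
def IsRMeasure (P : Measure (ℝ × ℝ)) : Prop :=
  P = (1/5 : ℝ≥0∞) • P.map (Smap 0) + (1/5 : ℝ≥0∞) • P.map (Smap 1)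
        + (3/5 : ℝ≥0∞) • P.map (Smap 2)

/-- The closed equilateral triangle with vertices (0,0), (1,0), (1/2, √3/2). -/
noncomputable def Δtri : Set (ℝ × ℝ) :=
  convexHull ℝ ({(0, 0), (1, 0), (1/2, Real.sqrt 3 / 2)} : Set (ℝ × ℝ))

/-- Squared Euclidean distance on ℝ². -/
def sqDist (x a : ℝ × ℝ) : ℝ := (x.1 - a.1) ^ 2 + (x.2 - a.2) ^ 2

/-- The distortion error `∫ min_{a ∈ α} ‖x − a‖² dP(x)` of a set `α` (Euclidean norm). -/
noncomputable def distortion (P : Measure (ℝ × ℝ)) (α : Set (ℝ × ℝ)) : ℝ :=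
  ∫ x, sInf ((fun a => sqDist x a) '' α) ∂P

/-- The `n`th quantization error `Vₙ(P)`. -/
noncomputable def quantErr (P : Measure (ℝ × ℝ)) (n : ℕ) : ℝ :=
  sInf { v | ∃ α : Set (ℝ × ℝ), 1 ≤ α.encard ∧ α.encard ≤ (n : ℕ∞) ∧ v = distortion P α }

/-- `α` is an optimal set of `n`-means for `P`. -/
def IsOptimalSet (P : Measure (ℝ × ℝ)) (n : ℕ) (α : Set (ℝ × ℝ)) : Prop :=
  1 ≤ α.encard ∧ α.encard ≤ (n : ℕ∞) ∧ distortion P α = quantErr P n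

/-! ### Integration against an R-measure -/

theorem Smap_zero (x : ℝ × ℝ) : Smap 0 x = (x.1 / 4, x.2 / 4) := rfl

theorem Smap_one (x : ℝ × ℝ) : Smap 1 x = (x.1 / 4 + 3 / 4, x.2 / 4) := rfl

theorem Smap_two (x : ℝ × ℝ) : Smap 2 x = (x.1 / 2 + 1 / 4, x.2 / 2 + √3 / 4) := rfl

theorem continuous_Smap (i : Fin 3) : Continuous (Smap i) := by
  match i with
  | 0 => exact (by fun_prop : Continuous fun x : ℝ × ℝ => (x.1 / 4, x.2 / 4))
  | 1 => exact (by fun_prop : Continuous fun x : ℝ × ℝ => (x.1 / 4 + 3 / 4, x.2 / 4))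
  | 2 => exact (by fun_prop : Continuous fun x : ℝ × ℝ => (x.1 / 2 + 1 / 4, x.2 / 2 + √3 / 4))

/-- A function which each `Smap i` contracts above zero is almost surely nonpositive. -/
theorem IsRMeasure.ae_nonpos {P : Measure (ℝ × ℝ)} [IsProbabilityMeasure P] (hP : IsRMeasure P)
    {g : ℝ × ℝ → ℝ} (hg : Measurable g) (h : ∀ i x, g (Smap i x) ≤ max 0 (g x) / 2) :
    ∀ᵐ x ∂P, g x ≤ 0 := by
  have hm : ∀ t : ℝ, MeasurableSet {x | t < g x} := fun t => measurableSet_lt measurable_const hg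
  have hS : ∀ i, Measurable (Smap i) := fun i => (continuous_Smap i).measurable
  have hstep : ∀ t : ℝ, 0 < t → P {x | t < g x} ≤ P {x | 2 * t < g x} := by
    intro t ht
    have hi : ∀ i, P.map (Smap i) {x | t < g x} ≤ P {x | 2 * t < g x} := by
      intro i
      rw [Measure.map_apply (hS i) (hm t)]
      refine measure_mono fun x hx => ?_
      have h1 : t < g (Smap i x) := hx
      have h2 := h i x
      show 2 * t < g x
      rcases max_cases 0 (g x) with h3 | h3 <;> linarith
    calc P {x | t < g x}
        = (1/5 : ℝ≥0∞) * P.map (Smap 0) {x | t < g x}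
          + (1/5 : ℝ≥0∞) * P.map (Smap 1) {x | t < g x}
          + (3/5 : ℝ≥0∞) * P.map (Smap 2) {x | t < g x} :=
          congrArg (fun μ : Measure (ℝ × ℝ) => μ {x | t < g x}) hP
      _ ≤ (1/5 : ℝ≥0∞) * P {x | 2 * t < g x} + (1/5 : ℝ≥0∞) * P {x | 2 * t < g x}
          + (3/5 : ℝ≥0∞) * P {x | 2 * t < g x} := by
          exact add_le_add (add_le_add (mul_le_mul_right (hi 0) _) (mul_le_mul_right (hi 1) _))
            (mul_le_mul_right (hi 2) _)
      _ = P {x | 2 * t < g x} := by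
          rw [← add_mul, ← add_mul, ENNReal.div_add_div_same, ENNReal.div_add_div_same]
          norm_num
          rw [ENNReal.div_self (by norm_num) (by norm_num), one_mul]
  have hpow : ∀ (t : ℝ), 0 < t → ∀ n : ℕ, P {x | t < g x} ≤ P {x | 2 ^ n * t < g x} := by
    intro t ht n
    induction n with
    | zero => simp
    | succ n ih =>
      refine ih.trans ((hstep _ (by positivity)).trans (le_of_eq ?_))
      rw [pow_succ' 2 n, mul_assoc]
  have hzero : ∀ t : ℝ, 0 < t → P {x | t < g x} = 0 := by
    intro t ht
    have hlim := tendsto_measure_iInter_atTop (μ := P) (s := fun n : ℕ => {x | 2 ^ n * t < g x})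
      (fun n => (hm _).nullMeasurableSet)
      (fun m n hmn x (hx : 2 ^ n * t < g x) => show 2 ^ m * t < g x from lt_of_le_of_lt
        (mul_le_mul_of_nonneg_right (pow_le_pow_right₀ (by norm_num) hmn) ht.le) hx)
      ⟨0, measure_ne_top _ _⟩
    have hempty : ⋂ n : ℕ, {x | 2 ^ n * t < g x} = ∅ := by
      refine eq_empty_of_forall_notMem fun x hx => ?_
      obtain ⟨n, hn⟩ := pow_unbounded_of_one_lt (g x / t) (one_lt_two : (1 : ℝ) < 2)
      have := mem_iInter.1 hx n
      rw [div_lt_iff₀ ht] at hn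
      exact lt_asymm hn this
    rw [hempty, measure_empty] at hlim
    exact le_antisymm (ge_of_tendsto' hlim (hpow t ht)) bot_le
  have hall : ∀ᵐ x ∂P, ∀ n : ℕ, g x ≤ 1 / ((n : ℝ) + 1) := by
    refine ae_all_iff.2 fun n => ?_
    rw [ae_iff]
    simpa only [not_le] using hzero _ Nat.one_div_pos_of_nat
  filter_upwards [hall] with x hx
  by_contra! hpos
  obtain ⟨n, hn⟩ := exists_nat_one_div_lt hpos
  exact absurd (hx n) (not_le.2 hn)

/-- An R-measure is carried by the triangle with vertices `(0, 0)`, `(1, 0)`, `(1/2, √3/2)`. -/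
theorem IsRMeasure.ae_mem_triangle {P : Measure (ℝ × ℝ)} [IsProbabilityMeasure P]
    (hP : IsRMeasure P) :
    ∀ᵐ x ∂P, 0 ≤ x.2 ∧ x.2 ≤ √3 * x.1 ∧ x.2 ≤ √3 * (1 - x.1) := by
  have h3 : 0 < √3 := by positivity
  have e1 := hP.ae_nonpos (g := fun x => -x.2) (by fun_prop) (by
    intro i x
    have := le_max_left 0 (-x.2)
    have := le_max_right 0 (-x.2)
    match i with
    | 0 => rw [Smap_zero]; dsimp only; linarith
    | 1 => rw [Smap_one]; dsimp only; linarith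
    | 2 => rw [Smap_two]; dsimp only; linarith)
  have e2 := hP.ae_nonpos (g := fun x => x.2 - √3 * x.1) (by fun_prop) (by
    intro i x
    have := le_max_left 0 (x.2 - √3 * x.1)
    have := le_max_right 0 (x.2 - √3 * x.1)
    match i with
    | 0 => rw [Smap_zero]; dsimp only; linarith
    | 1 => rw [Smap_one]; dsimp only; linarith
    | 2 => rw [Smap_two]; dsimp only; linarith)
  have e3 := hP.ae_nonpos (g := fun x => x.2 - √3 * (1 - x.1)) (by fun_prop) (by
    intro i x
    have := le_max_left 0 (x.2 - √3 * (1 - x.1))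
    have := le_max_right 0 (x.2 - √3 * (1 - x.1))
    match i with
    | 0 => rw [Smap_zero]; dsimp only; linarith
    | 1 => rw [Smap_one]; dsimp only; linarith
    | 2 => rw [Smap_two]; dsimp only; linarith)
  filter_upwards [e1, e2, e3] with x h1 h2 h3
  exact ⟨by linarith, by linarith, by linarith⟩

theorem IsRMeasure.integrable {P : Measure (ℝ × ℝ)} [IsProbabilityMeasure P]
    (hP : IsRMeasure P) {f : ℝ × ℝ → ℝ} (hf : Continuous f) : Integrable f P := by
  have h3 : 0 < √3 := by positivity
  obtain ⟨C, hC⟩ := (isCompact_Icc (a := ((0 : ℝ), (0 : ℝ)))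
    (b := (1, √3))).exists_bound_of_continuousOn hf.continuousOn
  refine Integrable.of_bound hf.aestronglyMeasurable C ?_
  filter_upwards [hP.ae_mem_triangle] with x hx
  obtain ⟨h1, h2, h4⟩ := hx
  refine hC x ⟨⟨?_, h1⟩, ⟨?_, ?_⟩⟩ <;> dsimp only <;> nlinarith

/-- The self-similarity of an R-measure, tested on a continuous function. -/
theorem IsRMeasure.integral_eq {P : Measure (ℝ × ℝ)} [IsProbabilityMeasure P]
    (hP : IsRMeasure P) {f : ℝ × ℝ → ℝ} (hf : Continuous f) :
    ∫ x, f x ∂P = 1/5 * ∫ x, f (Smap 0 x) ∂P + 1/5 * ∫ x, f (Smap 1 x) ∂P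
      + 3/5 * ∫ x, f (Smap 2 x) ∂P := by
  have hmap : ∀ i, ∫ x, f x ∂(P.map (Smap i)) = ∫ x, f (Smap i x) ∂P := fun i =>
    integral_map (continuous_Smap i).aemeasurable hf.aestronglyMeasurable
  have hfi : ∀ i, Integrable f (P.map (Smap i)) := fun i =>
    (integrable_map_measure hf.aestronglyMeasurable (continuous_Smap i).aemeasurable).2
      (hP.integrable (hf.comp (continuous_Smap i)))
  have h1 : (1/5 : ℝ≥0∞) ≠ ∞ := ENNReal.div_ne_top (by norm_num) (by norm_num)
  have h3 : (3/5 : ℝ≥0∞) ≠ ∞ := ENNReal.div_ne_top (by norm_num) (by norm_num)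
  refine (congrArg (fun μ : Measure (ℝ × ℝ) => ∫ x, f x ∂μ) hP).trans ?_
  rw [integral_add_measure (((hfi 0).smul_measure h1).add_measure ((hfi 1).smul_measure h1))
      ((hfi 2).smul_measure h3),
    integral_add_measure ((hfi 0).smul_measure h1) ((hfi 1).smul_measure h1)]
  simp only [integral_smul_measure, hmap, ENNReal.toReal_div, ENNReal.toReal_one,
    ENNReal.toReal_ofNat, smul_eq_mul]

theorem IsRMeasure.integral_fst {P : Measure (ℝ × ℝ)} [IsProbabilityMeasure P]
    (hP : IsRMeasure P) : ∫ x, x.1 ∂P = 1/2 := by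
  have h := hP.integral_eq continuous_fst
  have i1 : Integrable (fun x : ℝ × ℝ => x.1) P := hP.integrable continuous_fst
  have e0 : ∫ x, (Smap 0 x).1 ∂P = (∫ x, x.1 ∂P) / 4 := integral_div _ _
  have e1 : ∫ x, (Smap 1 x).1 ∂P = (∫ x, x.1 ∂P) / 4 + 3 / 4 := by
    simp only [Smap_one]
    rw [integral_add (i1.div_const _) (integrable_const _), integral_div]
    simp
  have e2 : ∫ x, (Smap 2 x).1 ∂P = (∫ x, x.1 ∂P) / 2 + 1 / 4 := by
    simp only [Smap_two]
    rw [integral_add (i1.div_const _) (integrable_const _), integral_div]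
    simp
  rw [e0, e1, e2] at h
  linarith

theorem IsRMeasure.integral_snd {P : Measure (ℝ × ℝ)} [IsProbabilityMeasure P]
    (hP : IsRMeasure P) : ∫ x, x.2 ∂P = √3 / 4 := by
  have h := hP.integral_eq continuous_snd
  have i1 : Integrable (fun x : ℝ × ℝ => x.2) P := hP.integrable continuous_snd
  have e0 : ∫ x, (Smap 0 x).2 ∂P = (∫ x, x.2 ∂P) / 4 := integral_div _ _
  have e1 : ∫ x, (Smap 1 x).2 ∂P = (∫ x, x.2 ∂P) / 4 := integral_div _ _
  have e2 : ∫ x, (Smap 2 x).2 ∂P = (∫ x, x.2 ∂P) / 2 + √3 / 4 := by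
    simp only [Smap_two]
    rw [integral_add (i1.div_const _) (integrable_const _), integral_div]
    simp
  rw [e0, e1, e2] at h
  linarith

theorem IsRMeasure.integral_affine {P : Measure (ℝ × ℝ)} [IsProbabilityMeasure P]
    (hP : IsRMeasure P) (r s t : ℝ) :
    ∫ x, (r * x.1 + s * x.2 + t) ∂P = r / 2 + s * (√3 / 4) + t := by
  have i1 : Integrable (fun x : ℝ × ℝ => r * x.1) P := hP.integrable (by fun_prop)
  have i2 : Integrable (fun x : ℝ × ℝ => s * x.2) P := hP.integrable (by fun_prop)
  rw [integral_add (hP.integrable (by fun_prop)) (integrable_const _), integral_add i1 i2,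
    integral_const_mul, integral_const_mul, hP.integral_fst, hP.integral_snd]
  simp
  ring

theorem IsRMeasure.integral_sq_add_affine {P : Measure (ℝ × ℝ)} [IsProbabilityMeasure P]
    (hP : IsRMeasure P) (q r s t : ℝ) :
    ∫ x, (q * (x.1 ^ 2 + x.2 ^ 2) + (r * x.1 + s * x.2 + t)) ∂P
      = q * ∫ x, (x.1 ^ 2 + x.2 ^ 2) ∂P + (r / 2 + s * (√3 / 4) + t) := by
  rw [integral_add (hP.integrable (by fun_prop)) (hP.integrable (by fun_prop)),
    integral_const_mul, hP.integral_affine]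

theorem IsRMeasure.integral_sq {P : Measure (ℝ × ℝ)} [IsProbabilityMeasure P]
    (hP : IsRMeasure P) : ∫ x, (x.1 ^ 2 + x.2 ^ 2) ∂P = 13/22 := by
  have h3 : √3 ^ 2 = 3 := Real.sq_sqrt (by norm_num)
  have h := hP.integral_eq (f := fun x => x.1 ^ 2 + x.2 ^ 2) (by fun_prop)
  have e0 : ∫ x, ((Smap 0 x).1 ^ 2 + (Smap 0 x).2 ^ 2) ∂P
      = 1/16 * ∫ x, (x.1 ^ 2 + x.2 ^ 2) ∂P + (0 / 2 + 0 * (√3 / 4) + 0) := by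
    rw [← hP.integral_sq_add_affine]
    congr 1; ext x; simp only [Smap_zero]; ring
  have e1 : ∫ x, ((Smap 1 x).1 ^ 2 + (Smap 1 x).2 ^ 2) ∂P
      = 1/16 * ∫ x, (x.1 ^ 2 + x.2 ^ 2) ∂P + ((3/8) / 2 + 0 * (√3 / 4) + 9/16) := by
    rw [← hP.integral_sq_add_affine]
    congr 1; ext x; simp only [Smap_one]; ring
  have e2 : ∫ x, ((Smap 2 x).1 ^ 2 + (Smap 2 x).2 ^ 2) ∂P
      = 1/4 * ∫ x, (x.1 ^ 2 + x.2 ^ 2) ∂P + ((1/4) / 2 + (√3 / 4) * (√3 / 4) + 1/4) := by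
    rw [← hP.integral_sq_add_affine]
    congr 1; ext x; simp only [Smap_two]
    linear_combination (1/16 : ℝ) * h3
  rw [e0, e1, e2] at h
  linear_combination (40/33 : ℝ) * h + (40/33 : ℝ) * (3/5) * (1/16) * h3

/-! ### Upper bounds for integrals of convex functions -/

theorem ConvexOn.comp_Smap {f : ℝ × ℝ → ℝ} (hf : ConvexOn ℝ univ f) (i : Fin 3) :
    ConvexOn ℝ univ (fun x => f (Smap i x)) := by
  refine ⟨convex_univ, fun x _ y _ s t hs ht hst => ?_⟩
  have h := hf.2 (mem_univ (Smap i x)) (mem_univ (Smap i y)) hs ht hst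
  convert h using 2
  obtain rfl : t = 1 - s := by linarith
  match i with
  | 0 => ext <;> simp [Smap_zero] <;> ring
  | 1 => ext <;> simp [Smap_one] <;> ring
  | 2 => ext <;> simp [Smap_two] <;> ring

/-- A convex function is dominated in mean by its values at the three vertices, weighted by the
barycentric coordinates of the mean. -/
theorem IsRMeasure.integral_le_vertices {P : Measure (ℝ × ℝ)} [IsProbabilityMeasure P]
    (hP : IsRMeasure P) {f : ℝ × ℝ → ℝ} (hf : Continuous f) (hc : ConvexOn ℝ univ f) :
    ∫ x, f x ∂P ≤ 1/4 * f (0, 0) + 1/4 * f (1, 0) + 1/2 * f (1/2, √3 / 2) := by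
  have h3 : √3 ^ 2 = 3 := Real.sq_sqrt (by norm_num)
  have h0 : 0 < √3 := by positivity
  set r : ℝ := f (1, 0) - f (0, 0) with hr
  set s : ℝ := (2 * f (1/2, √3 / 2) - f (0, 0) - f (1, 0)) * √3 / 3 with hs
  have key : ∀ᵐ x ∂P, f x ≤ r * x.1 + s * x.2 + f (0, 0) := by
    filter_upwards [hP.ae_mem_triangle] with x hx
    obtain ⟨h1, h2, h4⟩ := hx
    have hy : √3 * x.2 / 3 * √3 = x.2 := by linear_combination x.2 / 3 * h3
    have hw : ∀ i ∈ (Finset.univ : Finset (Fin 3)),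
        0 ≤ (![1 - x.1 - √3 * x.2 / 3, x.1 - √3 * x.2 / 3, 2 * √3 * x.2 / 3] : Fin 3 → ℝ) i := by
      intro i _
      fin_cases i <;> simp
      · nlinarith
      · nlinarith
      · positivity
    have h := hc.map_sum_le (t := Finset.univ)
      (w := ![1 - x.1 - √3 * x.2 / 3, x.1 - √3 * x.2 / 3, 2 * √3 * x.2 / 3])
      (p := ![((0 : ℝ), (0 : ℝ)), (1, 0), (1/2, √3 / 2)]) hw
      (by simp [Fin.sum_univ_three]; ring) (by simp)
    have hx' : x = ∑ i : Fin 3, (![1 - x.1 - √3 * x.2 / 3, x.1 - √3 * x.2 / 3, 2 * √3 * x.2 / 3] :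
        Fin 3 → ℝ) i • (![((0 : ℝ), (0 : ℝ)), (1, 0), (1/2, √3 / 2)] : Fin 3 → ℝ × ℝ) i := by
      ext
      · simp [Fin.sum_univ_three]; ring
      · simp [Fin.sum_univ_three]; linear_combination -x.2 / 3 * h3
    rw [← hx'] at h
    refine h.trans (le_of_eq ?_)
    simp [Fin.sum_univ_three, hr, hs]
    ring
  calc ∫ x, f x ∂P ≤ ∫ x, (r * x.1 + s * x.2 + f (0, 0)) ∂P :=
        integral_mono_ae (hP.integrable hf) (hP.integrable (by fun_prop)) key
    _ = r / 2 + s * (√3 / 4) + f (0, 0) := hP.integral_affine _ _ _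
    _ = _ := by
        rw [hr, hs]
        linear_combination (2 * f (1/2, √3 / 2) - f (0, 0) - f (1, 0)) / 12 * h3

/-- A two-point Jensen inequality in coordinates. -/
theorem ConvexOn.apply_le_of_eq {f : ℝ × ℝ → ℝ} (hc : ConvexOn ℝ univ f) (p q : ℝ × ℝ) {z : ℝ × ℝ}
    (s t : ℝ) (hs : 0 ≤ s) (ht : 0 ≤ t) (hst : s + t = 1)
    (h1 : z.1 = s * p.1 + t * q.1) (h2 : z.2 = s * p.2 + t * q.2) :
    f z ≤ s * f p + t * f q := by
  have hz : z = s • p + t • q := by ext <;> simp [h1, h2]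
  rw [hz]
  exact hc.2 (mem_univ p) (mem_univ q) hs ht hst

/-- An upper bound putting little weight on the vertices `(0, 0)` and `(1/4, 0)`. -/
theorem IsRMeasure.integral_le_left {P : Measure (ℝ × ℝ)} [IsProbabilityMeasure P]
    (hP : IsRMeasure P) {f : ℝ × ℝ → ℝ} (hf : Continuous f) (hc : ConvexOn ℝ univ f) :
    ∫ x, f x ∂P ≤ 1/10 * f (0, 0) + 1/15 * f (1/4, 0) + 7/30 * f (1, 0)
      + 1/5 * f (1/4, √3 / 4) + 2/5 * f (1/2, √3 / 2) := by
  have h0 := hP.integral_le_vertices (hf.comp (continuous_Smap 0)) (hc.comp_Smap 0)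
  have h1 := hP.integral_le_vertices (hf.comp (continuous_Smap 1)) (hc.comp_Smap 1)
  have h2 := hP.integral_le_vertices (hf.comp (continuous_Smap 2)) (hc.comp_Smap 2)
  simp only [Function.comp_apply] at h0 h1 h2
  have c0 := hc.apply_le_of_eq (0, 0) (1/4, √3 / 4) (z := Smap 0 (1/2, √3 / 2)) (1/2) (1/2)
    (by norm_num) (by norm_num) (by norm_num)
    (by norm_num [Smap_zero, Smap_one, Smap_two]) (by simp [Smap_zero]; ring)
  have c1 := hc.apply_le_of_eq (1, 0) (3/4, √3 / 4) (z := Smap 1 (1/2, √3 / 2)) (1/2) (1/2)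
    (by norm_num) (by norm_num) (by norm_num)
    (by norm_num [Smap_zero, Smap_one, Smap_two]) (by simp [Smap_one]; ring)
  have c2 := hc.apply_le_of_eq (1/4, 0) (1, 0) (z := Smap 1 (0, 0)) (1/3) (2/3)
    (by norm_num) (by norm_num) (by norm_num)
    (by norm_num [Smap_zero, Smap_one, Smap_two]) (by simp [Smap_one])
  have c3 := hc.apply_le_of_eq (1/2, √3 / 2) (1, 0) (z := (3/4, √3 / 4)) (1/2) (1/2)
    (by norm_num) (by norm_num) (by norm_num) (by norm_num) (by ring)
  have e0 : Smap 0 (0, 0) = (0, 0) := by simp [Smap_zero]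
  have e1 : Smap 0 (1, 0) = (1/4, 0) := by simp [Smap_zero]
  have e2 : Smap 1 (1, 0) = (1, 0) := by norm_num [Smap_zero, Smap_one, Smap_two]
  have e3 : Smap 2 (0, 0) = (1/4, √3 / 4) := by simp [Smap_two]
  have e4 : Smap 2 (1, 0) = (3/4, √3 / 4) := by norm_num [Smap_zero, Smap_one, Smap_two]
  have e5 : Smap 2 (1/2, √3 / 2) = (1/2, √3 / 2) := by
    ext <;> simp [Smap_two] <;> ring
  rw [e0, e1] at h0
  rw [e2] at h1
  rw [e3, e4, e5] at h2
  rw [hP.integral_eq hf]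
  linarith

/-- The mirror image of `IsRMeasure.integral_le_left`. -/
theorem IsRMeasure.integral_le_right {P : Measure (ℝ × ℝ)} [IsProbabilityMeasure P]
    (hP : IsRMeasure P) {f : ℝ × ℝ → ℝ} (hf : Continuous f) (hc : ConvexOn ℝ univ f) :
    ∫ x, f x ∂P ≤ 1/10 * f (1, 0) + 1/15 * f (3/4, 0) + 7/30 * f (0, 0)
      + 1/5 * f (3/4, √3 / 4) + 2/5 * f (1/2, √3 / 2) := by
  have h0 := hP.integral_le_vertices (hf.comp (continuous_Smap 0)) (hc.comp_Smap 0)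
  have h1 := hP.integral_le_vertices (hf.comp (continuous_Smap 1)) (hc.comp_Smap 1)
  have h2 := hP.integral_le_vertices (hf.comp (continuous_Smap 2)) (hc.comp_Smap 2)
  simp only [Function.comp_apply] at h0 h1 h2
  have c0 := hc.apply_le_of_eq (0, 0) (1/4, √3 / 4) (z := Smap 0 (1/2, √3 / 2)) (1/2) (1/2)
    (by norm_num) (by norm_num) (by norm_num)
    (by norm_num [Smap_zero, Smap_one, Smap_two]) (by simp [Smap_zero]; ring)
  have c1 := hc.apply_le_of_eq (1, 0) (3/4, √3 / 4) (z := Smap 1 (1/2, √3 / 2)) (1/2) (1/2)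
    (by norm_num) (by norm_num) (by norm_num)
    (by norm_num [Smap_zero, Smap_one, Smap_two]) (by simp [Smap_one]; ring)
  have c2 := hc.apply_le_of_eq (3/4, 0) (0, 0) (z := Smap 0 (1, 0)) (1/3) (2/3)
    (by norm_num) (by norm_num) (by norm_num)
    (by norm_num [Smap_zero, Smap_one, Smap_two]) (by simp [Smap_zero])
  have c3 := hc.apply_le_of_eq (1/2, √3 / 2) (0, 0) (z := (1/4, √3 / 4)) (1/2) (1/2)
    (by norm_num) (by norm_num) (by norm_num) (by norm_num) (by ring)
  have e0 : Smap 0 (0, 0) = (0, 0) := by simp [Smap_zero]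
  have e1 : Smap 1 (0, 0) = (3/4, 0) := by simp [Smap_one]
  have e2 : Smap 1 (1, 0) = (1, 0) := by norm_num [Smap_zero, Smap_one, Smap_two]
  have e3 : Smap 2 (0, 0) = (1/4, √3 / 4) := by simp [Smap_two]
  have e4 : Smap 2 (1, 0) = (3/4, √3 / 4) := by norm_num [Smap_zero, Smap_one, Smap_two]
  have e5 : Smap 2 (1/2, √3 / 2) = (1/2, √3 / 2) := by
    ext <;> simp [Smap_two] <;> ring
  rw [e0] at h0
  rw [e1, e2] at h1
  rw [e3, e4, e5] at h2
  rw [hP.integral_eq hf]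
  linarith

/-! ### Three-means clustering of finitely many integral atoms

An atom `(w, X, Y)` has mass `w` and sits at the point with coordinates `X` and `√3 * Y`. -/

/-- Accumulated mass, first moments and second moment of a cluster of atoms. -/
structure Cluster where
  mass : ℕ
  fst : ℕ
  snd : ℕ
  sq : ℕ
  deriving DecidableEq

namespace Cluster

/-- The empty cluster. -/
def empty : Cluster := ⟨0, 0, 0, 0⟩

/-- Insert an atom in a cluster. -/
def insert (s : Cluster) (a : ℕ × ℕ × ℕ) : Cluster :=
  ⟨s.mass + a.1, s.fst + a.1 * a.2.1, s.snd + a.1 * a.2.2,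
    s.sq + a.1 * (a.2.1 * a.2.1 + 3 * (a.2.2 * a.2.2))⟩

/-- The variance of a cluster around its own mean, rounded down. -/
def spread (s : Cluster) : ℕ :=
  (s.mass * s.sq - (s.fst * s.fst + 3 * (s.snd * s.snd))) / s.mass

/-- The second moment of a cluster around a given centre. -/
def moment (s : Cluster) (c : ℝ × ℝ) : ℝ :=
  s.sq - 2 * s.fst * c.1 - 6 * s.snd * c.2 + s.mass * (c.1 ^ 2 + 3 * c.2 ^ 2)

end Cluster

/-- The second moment of an atom around a given centre. -/
def atomMoment (a : ℕ × ℕ × ℕ) (c : ℝ × ℝ) : ℝ :=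
  a.1 * ((a.2.1 - c.1) ^ 2 + 3 * (a.2.2 - c.2) ^ 2)

theorem atomMoment_nonneg (a : ℕ × ℕ × ℕ) (c : ℝ × ℝ) : 0 ≤ atomMoment a c := by
  unfold atomMoment
  positivity

namespace Cluster

theorem moment_empty (c : ℝ × ℝ) : empty.moment c = 0 := by
  simp [moment, empty]

theorem moment_insert (s : Cluster) (a : ℕ × ℕ × ℕ) (c : ℝ × ℝ) :
    (s.insert a).moment c = s.moment c + atomMoment a c := by
  simp only [moment, insert, atomMoment]
  push_cast
  ring

theorem spread_le_moment (s : Cluster) (c : ℝ × ℝ) (h : 0 ≤ s.moment c) :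
    (s.spread : ℝ) ≤ s.moment c := by
  rcases Nat.eq_zero_or_pos s.mass with h0 | h0
  · simpa [spread, h0] using h
  have hm : (0 : ℝ) < s.mass := by exact_mod_cast h0
  have h1 : ((s.spread * s.mass : ℕ) : ℝ)
      ≤ ((s.mass * s.sq - (s.fst * s.fst + 3 * (s.snd * s.snd)) : ℕ) : ℝ) :=
    Nat.cast_le.2 (Nat.div_mul_le_self _ _)
  have h2 : ((s.mass * s.sq - (s.fst * s.fst + 3 * (s.snd * s.snd)) : ℕ) : ℝ)
      ≤ s.moment c * s.mass := by
    rcases le_total (s.fst * s.fst + 3 * (s.snd * s.snd)) (s.mass * s.sq) with h3 | h3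
    · rw [Nat.cast_sub h3]
      push_cast
      unfold moment
      nlinarith [sq_nonneg (s.mass * c.1 - s.fst), sq_nonneg (s.mass * c.2 - s.snd)]
    · rw [Nat.sub_eq_zero_of_le h3]
      simpa using mul_nonneg h hm.le
  rw [Nat.cast_mul] at h1
  exact le_of_mul_le_mul_right (h1.trans h2) hm

end Cluster

/-- Branch and bound: in every way of distributing the listed atoms over three given clusters,
either the total spread exceeds `T`, or the final clusters are `g 0`, `g 1`, `g 2` in some order. -/
def clusterCheck (T : ℕ) (g : Fin 3 → Cluster) :
    List (ℕ × ℕ × ℕ) → Cluster → Cluster → Cluster → Bool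
  | [], s, t, u => Nat.blt T (s.spread + t.spread + u.spread) ||
      decide (∃ σ : Equiv.Perm (Fin 3), s = g (σ 0) ∧ t = g (σ 1) ∧ u = g (σ 2))
  | a :: l, s, t, u => Nat.blt T (s.spread + t.spread + u.spread) ||
      (clusterCheck T g l (s.insert a) t u && clusterCheck T g l s (t.insert a) u &&
        clusterCheck T g l s t (u.insert a))

/-- The atoms of a discrete measure dominating an R-measure in the convex order, with masses in
units of `1/500` and coordinates in units of `1/32`. -/
def rAtoms : List (ℕ × ℕ × ℕ) :=
  [(50, 4, 4), (90, 16, 16), (25, 0, 0), (50, 28, 4), (25, 32, 0), (45, 12, 12), (25, 24, 0),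
    (25, 8, 0), (45, 20, 12), (24, 10, 10), (24, 22, 10), (12, 9, 9), (12, 23, 9), (14, 12, 8),
    (14, 20, 8), (6, 24, 8), (6, 8, 8), (4, 23, 8), (4, 9, 8)]

/-- The clusters of `rAtoms` lying in the three first-level triangles. -/
def rClusters : Fin 3 → Cluster :=
  ![⟨100, 400, 200, 4800⟩, ⟨100, 2800, 200, 81600⟩, ⟨300, 4800, 3600, 220200⟩]

theorem clusterCheck_rAtoms :
    clusterCheck 17800 rClusters rAtoms Cluster.empty Cluster.empty Cluster.empty = true := by
  decide +kernel

/-- The cost of the centres `c 0`, `c 1`, `c 2` for a list of atoms. -/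
noncomputable def atomCost (l : List (ℕ × ℕ × ℕ)) (c : Fin 3 → ℝ × ℝ) : ℝ :=
  (l.map fun a => min (min (atomMoment a (c 0)) (atomMoment a (c 1))) (atomMoment a (c 2))).sum

theorem atomCost_cons (a : ℕ × ℕ × ℕ) (l : List (ℕ × ℕ × ℕ)) (c : Fin 3 → ℝ × ℝ) :
    atomCost (a :: l) c
      = min (min (atomMoment a (c 0)) (atomMoment a (c 1))) (atomMoment a (c 2)) + atomCost l c :=
  rfl

theorem atomCost_nonneg (l : List (ℕ × ℕ × ℕ)) (c : Fin 3 → ℝ × ℝ) : 0 ≤ atomCost l c := by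
  refine List.sum_nonneg fun x hx => ?_
  obtain ⟨a, -, rfl⟩ := List.mem_map.1 hx
  exact le_min (le_min (atomMoment_nonneg _ _) (atomMoment_nonneg _ _)) (atomMoment_nonneg _ _)

theorem lt_of_blt_spread {T : ℕ} (c : Fin 3 → ℝ × ℝ) {l : List (ℕ × ℕ × ℕ)} {s t u : Cluster}
    (h : Nat.blt T (s.spread + t.spread + u.spread) = true)
    (hs : 0 ≤ s.moment (c 0)) (ht : 0 ≤ t.moment (c 1)) (hu : 0 ≤ u.moment (c 2)) :
    T < s.moment (c 0) + t.moment (c 1) + u.moment (c 2) + atomCost l c := by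
  have h1 : T < s.spread + t.spread + u.spread := Nat.le_of_ble_eq_true h
  have h2 : (T : ℝ) < s.spread + t.spread + u.spread := by exact_mod_cast h1
  linarith [s.spread_le_moment _ hs, t.spread_le_moment _ ht, u.spread_le_moment _ hu,
    atomCost_nonneg l c]

theorem clusterCheck_sound {T : ℕ} {g : Fin 3 → Cluster} (c : Fin 3 → ℝ × ℝ)
    {l : List (ℕ × ℕ × ℕ)} {s t u : Cluster} (h : clusterCheck T g l s t u = true)
    (hs : 0 ≤ s.moment (c 0)) (ht : 0 ≤ t.moment (c 1)) (hu : 0 ≤ u.moment (c 2)) :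
    T < s.moment (c 0) + t.moment (c 1) + u.moment (c 2) + atomCost l c ∨
      ∃ σ : Equiv.Perm (Fin 3), s.moment (c 0) + t.moment (c 1) + u.moment (c 2)
        + atomCost l c = ∑ i, (g (σ i)).moment (c i) := by
  induction l generalizing s t u with
  | nil =>
    rw [clusterCheck, Bool.or_eq_true, decide_eq_true_iff] at h
    rcases h with h | ⟨σ, rfl, rfl, rfl⟩
    · exact Or.inl (lt_of_blt_spread c h hs ht hu)
    · exact Or.inr ⟨σ, by simp [Fin.sum_univ_three, atomCost]⟩
  | cons a l ih =>
    rw [clusterCheck, Bool.or_eq_true, Bool.and_eq_true, Bool.and_eq_true] at h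
    rcases h with h | ⟨⟨h0, h1⟩, h2⟩
    · exact Or.inl (lt_of_blt_spread c h hs ht hu)
    have ha := fun i => atomMoment_nonneg a (c i)
    have e0 := s.moment_insert a (c 0)
    have e1 := t.moment_insert a (c 1)
    have e2 := u.moment_insert a (c 2)
    rw [atomCost_cons]
    rcases min_choice (min (atomMoment a (c 0)) (atomMoment a (c 1))) (atomMoment a (c 2))
      with hm | hm <;> rw [hm]
    · rcases min_choice (atomMoment a (c 0)) (atomMoment a (c 1)) with hm | hm <;> rw [hm]
      · exact (ih h0 (by linarith [ha 0]) ht hu).imp (fun h => by linarith)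
          fun ⟨σ, h⟩ => ⟨σ, by linarith⟩
      · exact (ih h1 hs (by linarith [ha 1]) hu).imp (fun h => by linarith)
          fun ⟨σ, h⟩ => ⟨σ, by linarith⟩
    · exact (ih h2 hs ht (by linarith [ha 2])).imp (fun h => by linarith)
        fun ⟨σ, h⟩ => ⟨σ, by linarith⟩

/-- The means of the three clusters `rClusters`. -/
def rMeans : Fin 3 → ℝ × ℝ := ![(4, 2), (28, 2), (16, 12)]

theorem moment_rClusters (j : Fin 3) (p : ℝ × ℝ) :
    (rClusters j).moment p = (![2000, 2000, 13800] : Fin 3 → ℝ) j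
      + (![100, 100, 300] : Fin 3 → ℝ) j
        * ((p.1 - (rMeans j).1) ^ 2 + 3 * (p.2 - (rMeans j).2) ^ 2) := by
  match j with
  | 0 => simp [rClusters, rMeans, Cluster.moment]; ring
  | 1 => simp [rClusters, rMeans, Cluster.moment]; ring
  | 2 => simp [rClusters, rMeans, Cluster.moment]; ring

theorem atomCost_rAtoms_cases (c : Fin 3 → ℝ × ℝ) :
    17800 < atomCost rAtoms c ∨ ∃ σ : Equiv.Perm (Fin 3), atomCost rAtoms c
      = 17800 + ∑ j, (![100, 100, 300] : Fin 3 → ℝ) j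
        * (((c (σ j)).1 - (rMeans j).1) ^ 2 + 3 * ((c (σ j)).2 - (rMeans j).2) ^ 2) := by
  have h := clusterCheck_sound c clusterCheck_rAtoms (Cluster.moment_empty _).ge
    (Cluster.moment_empty _).ge (Cluster.moment_empty _).ge
  simp only [Cluster.moment_empty, zero_add] at h
  refine h.imp (fun h => by exact_mod_cast h) fun ⟨σ, h⟩ => ⟨σ.symm, ?_⟩
  rw [h, ← Equiv.sum_comp σ.symm]
  simp only [Equiv.apply_symm_apply, moment_rClusters, Finset.sum_add_distrib]
  congr 1
  rw [Fin.sum_univ_three]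
  change (2000 : ℝ) + 2000 + 13800 = 17800
  norm_num

theorem le_atomCost_rAtoms (c : Fin 3 → ℝ × ℝ) : 17800 ≤ atomCost rAtoms c := by
  rcases atomCost_rAtoms_cases c with h | ⟨σ, h⟩
  · exact h.le
  · rw [h]
    simp only [Fin.sum_univ_three, Matrix.cons_val]
    linarith [sq_nonneg ((c (σ 0)).1 - (rMeans 0).1), sq_nonneg ((c (σ 0)).2 - (rMeans 0).2),
      sq_nonneg ((c (σ 1)).1 - (rMeans 1).1), sq_nonneg ((c (σ 1)).2 - (rMeans 1).2),
      sq_nonneg ((c (σ 2)).1 - (rMeans 2).1), sq_nonneg ((c (σ 2)).2 - (rMeans 2).2)]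

theorem range_eq_of_atomCost_le {c : Fin 3 → ℝ × ℝ} (hc : atomCost rAtoms c ≤ 17800) :
    range c = range rMeans := by
  rcases atomCost_rAtoms_cases c with h | ⟨σ, h⟩
  · exact absurd h hc.not_gt
  · have hpos : ∀ j ∈ (Finset.univ : Finset (Fin 3)), 0 ≤ (![100, 100, 300] : Fin 3 → ℝ) j
        * (((c (σ j)).1 - (rMeans j).1) ^ 2 + 3 * ((c (σ j)).2 - (rMeans j).2) ^ 2) := by
      intro j _
      refine mul_nonneg ?_ (by positivity)
      fin_cases j <;> simp
    have h0 := (Finset.sum_eq_zero_iff_of_nonneg hpos).1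
      (le_antisymm (by linarith) (Finset.sum_nonneg hpos))
    have hσ : c ∘ σ = rMeans := by
      funext j
      have hj := (mul_eq_zero.1 (h0 j (Finset.mem_univ j))).resolve_left
        (by fin_cases j <;> simp)
      ext <;> simp only [Function.comp_apply] <;> nlinarith
    rw [← hσ, σ.surjective.range_comp]

/-- The position in the plane of an atom of `rAtoms`. -/
noncomputable def atomPt (a : ℕ × ℕ × ℕ) : ℝ × ℝ := (a.2.1 / 32, √3 * a.2.2 / 32)

/-- In the convex order an R-measure is dominated by the discrete measure `rAtoms`. -/
theorem IsRMeasure.integral_le_rAtoms {P : Measure (ℝ × ℝ)} [IsProbabilityMeasure P]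
    (hP : IsRMeasure P) {f : ℝ × ℝ → ℝ} (hf : Continuous f) (hc : ConvexOn ℝ univ f) :
    ∫ x, f x ∂P ≤ (rAtoms.map fun a => (a.1 : ℝ) / 500 * f (atomPt a)).sum := by
  have hf2 := hf.comp (continuous_Smap 2)
  have hc2 := hc.comp_Smap 2
  have h0 := hP.integral_le_vertices (hf.comp (continuous_Smap 0)) (hc.comp_Smap 0)
  have h1 := hP.integral_le_vertices (hf.comp (continuous_Smap 1)) (hc.comp_Smap 1)
  have h20 := hP.integral_le_left (hf2.comp (continuous_Smap 0)) (hc2.comp_Smap 0)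
  have h21 := hP.integral_le_right (hf2.comp (continuous_Smap 1)) (hc2.comp_Smap 1)
  have h22 := hP.integral_le_vertices (hf2.comp (continuous_Smap 2)) (hc2.comp_Smap 2)
  have e1 := hP.integral_eq hf
  have e2 := hP.integral_eq hf2
  simp only [Function.comp_apply, Smap_zero, Smap_one, Smap_two] at h0 h1 h20 h21 h22 e1 e2
  rw [e1, e2]
  simp only [rAtoms, atomPt, List.map_cons, List.map_nil, List.sum_cons, List.sum_nil]
  ring_nf at h0 h1 h20 h21 h22 ⊢
  linarith

/-! ### Distortion of three centres -/

theorem exists_range_eq_of_encard_le {β : Type*} {α : Set β} {n : ℕ} (h1 : 1 ≤ α.encard)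
    (hn : α.encard ≤ n) : ∃ c : Fin n → β, range c = α := by
  obtain ⟨hfin, hcard⟩ := encard_le_coe_iff_finite_ncard_le.1 hn
  have : Nonempty α := (one_le_encard_iff_nonempty.1 h1).to_subtype
  have : Fintype α := hfin.fintype
  obtain ⟨e⟩ := Function.Embedding.nonempty_of_card_le (α := α) (β := Fin n) (by
    rwa [Fintype.card_fin, ← Nat.card_eq_fintype_card, Nat.card_coe_set_eq])
  refine ⟨Subtype.val ∘ Function.invFun e, ?_⟩
  rw [(Function.invFun_surjective e.injective).range_comp, Subtype.range_coe]

theorem range_fin_three {β : Type*} (c : Fin 3 → β) : range c = {c 0, c 1, c 2} := by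
  ext x
  simp [Fin.exists_fin_succ, eq_comm]

/-- The squared distance to the nearest of three centres. -/
noncomputable def minSqDist (c : Fin 3 → ℝ × ℝ) (x : ℝ × ℝ) : ℝ :=
  min (min (sqDist x (c 0)) (sqDist x (c 1))) (sqDist x (c 2))

theorem distortion_range (P : Measure (ℝ × ℝ)) (c : Fin 3 → ℝ × ℝ) :
    distortion P (range c) = ∫ x, minSqDist c x ∂P := by
  unfold distortion
  congr 1
  ext x
  rw [range_fin_three, image_insert_eq, image_pair, csInf_insert (toFinite _).bddBelow
    (insert_nonempty _ _), csInf_pair, minSqDist, min_assoc]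

theorem continuous_sqDist (a : ℝ × ℝ) : Continuous fun x => sqDist x a := by
  unfold sqDist
  fun_prop

theorem continuous_minSqDist (c : Fin 3 → ℝ × ℝ) : Continuous (minSqDist c) :=
  ((continuous_sqDist _).min (continuous_sqDist _)).min (continuous_sqDist _)

theorem convexOn_normSq_sub_minSqDist (c : Fin 3 → ℝ × ℝ) :
    ConvexOn ℝ univ fun x => (x.1 ^ 2 + x.2 ^ 2) - minSqDist c x := by
  have haff : ∀ a : ℝ × ℝ, ConvexOn ℝ univ fun x => (x.1 ^ 2 + x.2 ^ 2) - sqDist x a := by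
    refine fun a => ⟨convex_univ, fun x _ y _ s t _ _ hst => le_of_eq ?_⟩
    obtain rfl : t = 1 - s := by linarith
    simp only [sqDist, Prod.fst_add, Prod.snd_add, Prod.smul_fst, Prod.smul_snd, smul_eq_mul]
    ring
  refine (((haff (c 0)).sup (haff (c 1))).sup (haff (c 2))).congr fun x _ => ?_
  simp only [Pi.sup_apply, minSqDist, max_sub_sub_left]

/-- Coordinates of a centre in the scale of `rAtoms`. -/
noncomputable def rScale (p : ℝ × ℝ) : ℝ × ℝ := (32 * p.1, 32 * √3 / 3 * p.2)

theorem rScale_injective : Function.Injective rScale := by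
  intro p q h
  have h0 : 32 * √3 / 3 ≠ 0 := by positivity
  have h1 := congrArg Prod.fst h
  have h2 := congrArg Prod.snd h
  simp only [rScale] at h1 h2
  exact Prod.ext (by linarith) (mul_left_cancel₀ h0 h2)

theorem mul_sqDist_atomPt (a : ℕ × ℕ × ℕ) (p : ℝ × ℝ) :
    a.1 * sqDist (atomPt a) p = atomMoment a (rScale p) / 1024 := by
  have h3 : √3 ^ 2 = 3 := Real.sq_sqrt (by norm_num)
  simp only [atomPt, sqDist, atomMoment, rScale]
  linear_combination (a.1 * ((a.2.2 : ℝ) ^ 2 / 1024 - p.2 ^ 2 / 3)) * h3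

theorem sum_atoms (l : List (ℕ × ℕ × ℕ)) (c : Fin 3 → ℝ × ℝ) :
    (l.map fun a => (a.1 : ℝ) / 500
        * (((atomPt a).1 ^ 2 + (atomPt a).2 ^ 2) - minSqDist c (atomPt a))).sum
      = ((l.map fun a => atomMoment a 0).sum - atomCost l (rScale ∘ c)) / 512000 := by
  induction l with
  | nil => simp [atomCost]
  | cons a l ih =>
    have h0 := mul_sqDist_atomPt a 0
    have h1 : a.1 * minSqDist c (atomPt a) = min (min (atomMoment a (rScale (c 0)))
        (atomMoment a (rScale (c 1)))) (atomMoment a (rScale (c 2))) / 1024 := by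
      rw [minSqDist, mul_min_of_nonneg _ _ a.1.cast_nonneg, mul_min_of_nonneg _ _ a.1.cast_nonneg,
        mul_sqDist_atomPt, mul_sqDist_atomPt, mul_sqDist_atomPt, min_div_div_right (by norm_num),
        min_div_div_right (by norm_num)]
    have h2 : rScale 0 = 0 := by simp [rScale]
    rw [h2] at h0
    simp only [sqDist, Prod.fst_zero, Prod.snd_zero, sub_zero] at h0
    rw [List.map_cons, List.sum_cons, ih, List.map_cons, List.sum_cons, atomCost_cons]
    simp only [Function.comp_apply]
    linear_combination h0 / 500 - h1 / 500

theorem IsRMeasure.le_distortion {P : Measure (ℝ × ℝ)} [IsProbabilityMeasure P]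
    (hP : IsRMeasure P) (c : Fin 3 → ℝ × ℝ) :
    189/7040 + (atomCost rAtoms (rScale ∘ c) - 17800) / 512000 ≤ distortion P (range c) := by
  have hm := continuous_minSqDist c
  have hsq : Continuous fun x : ℝ × ℝ => x.1 ^ 2 + x.2 ^ 2 := by fun_prop
  have h := hP.integral_le_rAtoms (hsq.sub hm) (convexOn_normSq_sub_minSqDist c)
  simp only [Pi.sub_apply] at h
  rw [sum_atoms, integral_sub (hP.integrable hsq) (hP.integrable hm), hP.integral_sq] at h
  have h0 : (rAtoms.map fun a => atomMoment a 0).sum = 306600 := by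
    norm_num [rAtoms, atomMoment]
  rw [h0] at h
  rw [distortion_range]
  linarith

/-- The means of an R-measure over the three first-level triangles. -/
noncomputable def rCenters : Fin 3 → ℝ × ℝ :=
  ![(1/8, √3 / 16), (7/8, √3 / 16), (1/2, 3 * √3 / 8)]

theorem rScale_comp_rCenters : rScale ∘ rCenters = rMeans := by
  have h3 : √3 ^ 2 = 3 := Real.sq_sqrt (by norm_num)
  funext i
  match i with
  | 0 => ext <;> simp [rScale, rCenters, rMeans] <;> linarith
  | 1 => ext <;> simp [rScale, rCenters, rMeans] <;> linarith
  | 2 => ext <;> simp [rScale, rCenters, rMeans] <;> linarith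

theorem IsRMeasure.distortion_rCenters_le {P : Measure (ℝ × ℝ)} [IsProbabilityMeasure P]
    (hP : IsRMeasure P) : distortion P (range rCenters) ≤ 189/7040 := by
  have h3 : √3 ^ 2 = 3 := Real.sq_sqrt (by norm_num)
  have hm := continuous_minSqDist rCenters
  have hle : ∀ i, ∫ x, minSqDist rCenters (Smap i x) ∂P
      ≤ ∫ x, sqDist (Smap i x) (rCenters i) ∂P := by
    intro i
    refine integral_mono (hP.integrable (hm.comp (continuous_Smap i)))
      (hP.integrable ((continuous_sqDist _).comp (continuous_Smap i))) fun x => ?_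
    match i with
    | 0 => exact (min_le_left _ _).trans (min_le_left _ _)
    | 1 => exact (min_le_left _ _).trans (min_le_right _ _)
    | 2 => exact min_le_right _ _
  have e0 : ∫ x, sqDist (Smap 0 x) (rCenters 0) ∂P = 1/16 * ∫ x, (x.1 ^ 2 + x.2 ^ 2) ∂P
      + ((-1/16) / 2 + (-√3 / 32) * (√3 / 4) + (1/64 + 3/256)) := by
    rw [← hP.integral_sq_add_affine]
    congr 1; ext x; simp only [Smap_zero, sqDist, rCenters, Matrix.cons_val]
    linear_combination (1/256 : ℝ) * h3
  have e1 : ∫ x, sqDist (Smap 1 x) (rCenters 1) ∂P = 1/16 * ∫ x, (x.1 ^ 2 + x.2 ^ 2) ∂P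
      + ((-1/16) / 2 + (-√3 / 32) * (√3 / 4) + (1/64 + 3/256)) := by
    rw [← hP.integral_sq_add_affine]
    congr 1; ext x; simp only [Smap_one, sqDist, rCenters, Matrix.cons_val]
    linear_combination (1/256 : ℝ) * h3
  have e2 : ∫ x, sqDist (Smap 2 x) (rCenters 2) ∂P = 1/4 * ∫ x, (x.1 ^ 2 + x.2 ^ 2) ∂P
      + ((-1/4) / 2 + (-√3 / 8) * (√3 / 4) + (1/16 + 3/64)) := by
    rw [← hP.integral_sq_add_affine]
    congr 1; ext x; simp only [Smap_two, sqDist, rCenters, Matrix.cons_val]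
    linear_combination (1/64 : ℝ) * h3
  rw [distortion_range, hP.integral_eq hm]
  rw [hP.integral_sq] at e0 e1 e2
  linarith [hle 0, hle 1, hle 2]

theorem IsRMeasure.quantErr_three {P : Measure (ℝ × ℝ)} [IsProbabilityMeasure P]
    (hP : IsRMeasure P) : quantErr P 3 = 189/7040 := by
  have hle : ∀ c, 189/7040 ≤ distortion P (range c) := fun c => by
    linarith [hP.le_distortion c, le_atomCost_rAtoms (rScale ∘ c)]
  refine IsLeast.csInf_eq ⟨⟨range rCenters, ?_, ?_, ?_⟩, ?_⟩
  · exact one_le_encard_iff_nonempty.2 (range_nonempty _)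
  · rw [← image_univ]
    exact (encard_image_le _ _).trans (by simp [encard_univ])
  · exact (hle _).antisymm hP.distortion_rCenters_le
  · rintro v ⟨α, h1, h3, rfl⟩
    obtain ⟨c, rfl⟩ := exists_range_eq_of_encard_le h1 h3
    exact hle c

/-- Every optimal set of three-means equals `{(1/8, √3/16), (7/8, √3/16), (1/2, 3√3/8)}`,
and `V₃(P) = 189/7040`. -/
theorem stmt_11 (P : Measure (ℝ × ℝ)) [IsProbabilityMeasure P] (hP : IsRMeasure P) :
    (∀ α : Set (ℝ × ℝ), IsOptimalSet P 3 α →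
      α = ({(1/8, Real.sqrt 3 / 16), (7/8, Real.sqrt 3 / 16),
            (1/2, 3 * Real.sqrt 3 / 8)} : Set (ℝ × ℝ))) ∧
    quantErr P 3 = 189/7040 := by
  refine ⟨fun α hα => ?_, hP.quantErr_three⟩
  obtain ⟨h1, h3, h⟩ := hα
  obtain ⟨c, rfl⟩ := exists_range_eq_of_encard_le h1 h3
  rw [hP.quantErr_three] at h
  have hr := range_eq_of_atomCost_le (c := rScale ∘ c) (by linarith [hP.le_distortion c])
  rw [← rScale_comp_rCenters, range_comp, range_comp] at hr
  rw [rScale_injective.image_injective hr, range_fin_three]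
  rfl
end

section
/- Let n ≥ 3 and let αₙ be an optimal set of n-means for P. Then every point c ∈ αₙ satisfies either c = a(ω) for some word ω over {1,2,3}, or c = a(ω1, ω2) for some (possibly empty) word ω over {1,2,3}. -/
open MeasureTheory Real Set
open scoped ENNReal NNReal

/-- `a(ω) = S_ω(1/2, √3/4)`. -/
noncomputable def aw (ω : List (Fin 3)) : ℝ × ℝ := Sw ω (1/2, Real.sqrt 3 / 4)

/-- `a(ω1, ω2) = (S_{ω1}(1/2, √3/4) + S_{ω2}(1/2, √3/4))/2`. -/
noncomputable def a12 (ω : List (Fin 3)) : ℝ × ℝ :=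
  (1/2 : ℝ) • (aw (ω ++ [0]) + aw (ω ++ [1]))

namespace RTriangle

/-- The lower left map of the R-triangle, in the coordinates `(x₁, x₂ / √3)`. -/
noncomputable def T₁ (x : ℝ × ℝ) : ℝ × ℝ := (x.1 / 4, x.2 / 4)

/-- The lower right map of the R-triangle, in the coordinates `(x₁, x₂ / √3)`. -/
noncomputable def T₂ (x : ℝ × ℝ) : ℝ × ℝ := (x.1 / 4 + 3 / 4, x.2 / 4)

/-- The upper map of the R-triangle, in the coordinates `(x₁, x₂ / √3)`. -/
noncomputable def T₃ (x : ℝ × ℝ) : ℝ × ℝ := (x.1 / 2 + 1 / 4, x.2 / 2 + 1 / 4)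

/-- The inverse of `T₁`. -/
noncomputable def R₁ (x : ℝ × ℝ) : ℝ × ℝ := (4 * x.1, 4 * x.2)

/-- The inverse of `T₂`. -/
noncomputable def R₂ (x : ℝ × ℝ) : ℝ × ℝ := (4 * x.1 - 3, 4 * x.2)

/-- The inverse of `T₃`. -/
noncomputable def R₃ (x : ℝ × ℝ) : ℝ × ℝ := (2 * x.1 - 1 / 2, 2 * x.2 - 1 / 2)

@[simp] lemma T₁_R₁ (x) : T₁ (R₁ x) = x := by ext <;> simp [T₁, R₁]
@[simp] lemma T₂_R₂ (x) : T₂ (R₂ x) = x := by ext <;> simp [T₂, R₂]; ring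
@[simp] lemma T₃_R₃ (x) : T₃ (R₃ x) = x := by ext <;> simp [T₃, R₃] <;> ring
@[simp] lemma R₁_T₁ (x) : R₁ (T₁ x) = x := by ext <;> simp [T₁, R₁] <;> ring
@[simp] lemma R₂_T₂ (x) : R₂ (T₂ x) = x := by ext <;> simp [T₂, R₂] <;> ring
@[simp] lemma R₃_T₃ (x) : R₃ (T₃ x) = x := by ext <;> simp [T₃, R₃] <;> ring

lemma continuous_T₁ : Continuous T₁ := by unfold T₁; fun_prop
lemma continuous_T₂ : Continuous T₂ := by unfold T₂; fun_prop
lemma continuous_T₃ : Continuous T₃ := by unfold T₃; fun_prop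
lemma continuous_R₁ : Continuous R₁ := by unfold R₁; fun_prop
lemma continuous_R₂ : Continuous R₂ := by unfold R₂; fun_prop
lemma continuous_R₃ : Continuous R₃ := by unfold R₃; fun_prop

lemma emb_T₁ : MeasurableEmbedding T₁ :=
  (Homeomorph.mk ⟨T₁, R₁, R₁_T₁, T₁_R₁⟩ continuous_T₁ continuous_R₁).measurableEmbedding
lemma emb_T₂ : MeasurableEmbedding T₂ :=
  (Homeomorph.mk ⟨T₂, R₂, R₂_T₂, T₂_R₂⟩ continuous_T₂ continuous_R₂).measurableEmbedding
lemma emb_T₃ : MeasurableEmbedding T₃ :=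
  (Homeomorph.mk ⟨T₃, R₃, R₃_T₃, T₃_R₃⟩ continuous_T₃ continuous_R₃).measurableEmbedding

/-- The self-similarity of the nonhomogeneous R-measure, in the coordinates `(x₁, x₂ / √3)`. -/
def SelfSim (Q : Measure (ℝ × ℝ)) : Prop :=
  Q = (1/5 : ℝ≥0∞) • Q.map T₁ + (1/5 : ℝ≥0∞) • Q.map T₂ + (3/5 : ℝ≥0∞) • Q.map T₃

section
variable {Q : Measure (ℝ × ℝ)}

lemma fifth_ne_zero : (1/5 : ℝ≥0∞) ≠ 0 := by simp
lemma fifth_ne_top : (1/5 : ℝ≥0∞) ≠ ∞ := by simp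
lemma three_fifths_ne_zero : (3/5 : ℝ≥0∞) ≠ 0 := by simp
lemma three_fifths_ne_top : (3/5 : ℝ≥0∞) ≠ ∞ := by simp [ENNReal.div_eq_top]

lemma SelfSim.integrable_iff (hQ : SelfSim Q) {g : ℝ × ℝ → ℝ} :
    Integrable g Q ↔ Integrable (fun x => g (T₁ x)) Q ∧ Integrable (fun x => g (T₂ x)) Q ∧
      Integrable (fun x => g (T₃ x)) Q := by
  conv_lhs => rw [hQ]
  rw [integrable_add_measure, integrable_add_measure,
    integrable_smul_measure fifth_ne_zero fifth_ne_top,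
    integrable_smul_measure fifth_ne_zero fifth_ne_top,
    integrable_smul_measure three_fifths_ne_zero three_fifths_ne_top,
    emb_T₁.integrable_map_iff, emb_T₂.integrable_map_iff, emb_T₃.integrable_map_iff, and_assoc]
  rfl

lemma SelfSim.integral_eq (hQ : SelfSim Q) {g : ℝ × ℝ → ℝ} (hg : Integrable g Q) :
    ∫ x, g x ∂Q = 1/5 * ∫ x, g (T₁ x) ∂Q + 1/5 * ∫ x, g (T₂ x) ∂Q
      + 3/5 * ∫ x, g (T₃ x) ∂Q := by
  obtain ⟨h1, h2, h3⟩ := hQ.integrable_iff.1 hg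
  have e : ∫ x, g x ∂Q = ∫ x, g x ∂((1/5 : ℝ≥0∞) • Q.map T₁ + (1/5 : ℝ≥0∞) • Q.map T₂
      + (3/5 : ℝ≥0∞) • Q.map T₃) := by
    conv_lhs => rw [hQ]
  have i1 : Integrable g ((1/5 : ℝ≥0∞) • Q.map T₁) :=
    (integrable_smul_measure fifth_ne_zero fifth_ne_top).2 (emb_T₁.integrable_map_iff.2 h1)
  have i2 : Integrable g ((1/5 : ℝ≥0∞) • Q.map T₂) :=
    (integrable_smul_measure fifth_ne_zero fifth_ne_top).2 (emb_T₂.integrable_map_iff.2 h2)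
  have i3 : Integrable g ((3/5 : ℝ≥0∞) • Q.map T₃) :=
    (integrable_smul_measure three_fifths_ne_zero three_fifths_ne_top).2
      (emb_T₃.integrable_map_iff.2 h3)
  rw [e, integral_add_measure (i1.add_measure i2) i3, integral_add_measure i1 i2,
    integral_smul_measure, integral_smul_measure, integral_smul_measure,
    emb_T₁.integral_map, emb_T₂.integral_map, emb_T₃.integral_map]
  simp

lemma SelfSim.measure_le (hQ : SelfSim Q) {A B : Set (ℝ × ℝ)}
    (h1 : T₁ ⁻¹' A ⊆ B) (h2 : T₂ ⁻¹' A ⊆ B) (h3 : T₃ ⁻¹' A ⊆ B) : Q A ≤ Q B := by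
  have e : Q A = 1/5 * Q (T₁ ⁻¹' A) + 1/5 * Q (T₂ ⁻¹' A) + 3/5 * Q (T₃ ⁻¹' A) := by
    conv_lhs => rw [hQ]
    simp only [Measure.add_apply, Measure.smul_apply, smul_eq_mul, emb_T₁.map_apply,
      emb_T₂.map_apply, emb_T₃.map_apply]
  calc Q A ≤ 1/5 * Q B + 1/5 * Q B + 3/5 * Q B := by
        rw [e]; gcongr
    _ = Q B := by
        rw [← add_mul, ← add_mul, ENNReal.div_add_div_same, ENNReal.div_add_div_same]
        norm_num
        rw [ENNReal.div_self (by norm_num) (by norm_num), one_mul]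

lemma SelfSim.ae_nonpos [IsProbabilityMeasure Q] (hQ : SelfSim Q) {l : ℝ × ℝ → ℝ}
    (hl : Continuous l)
    (h1 : ∀ x, 0 < l (T₁ x) → 2 * l (T₁ x) ≤ l x) (h2 : ∀ x, 0 < l (T₂ x) → 2 * l (T₂ x) ≤ l x)
    (h3 : ∀ x, 0 < l (T₃ x) → 2 * l (T₃ x) ≤ l x) : ∀ᵐ x ∂Q, l x ≤ 0 := by
  have meas : ∀ t : ℝ, MeasurableSet {x | t < l x} := fun t =>
    measurableSet_lt measurable_const hl.measurable
  have step : ∀ t : ℝ, 0 < t → Q {x | t < l x} ≤ Q {x | 2 * t < l x} := fun t ht =>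
    hQ.measure_le
      (fun x (hx : t < _) => show 2 * t < l x by linarith [h1 x (ht.trans hx)])
      (fun x (hx : t < _) => show 2 * t < l x by linarith [h2 x (ht.trans hx)])
      (fun x (hx : t < _) => show 2 * t < l x by linarith [h3 x (ht.trans hx)])
  have iter : ∀ t : ℝ, 0 < t → ∀ k : ℕ, Q {x | t < l x} ≤ Q {x | 2 ^ k * t < l x} := by
    intro t ht k
    induction k with
    | zero => simp
    | succ k ih =>
      refine ih.trans ((step _ (by positivity)).trans_eq ?_)
      rw [pow_succ']; simp only [mul_assoc]
  have zero : ∀ t : ℝ, 0 < t → Q {x | t < l x} = 0 := by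
    intro t ht
    have hanti : Antitone fun k : ℕ => {x | 2 ^ k * t < l x} := by
      intro i j hij x (hx : 2 ^ j * t < l x)
      refine lt_of_le_of_lt ?_ hx
      gcongr
      norm_num
    have hlim := tendsto_measure_iInter_atTop (μ := Q) (s := fun k : ℕ => {x | 2 ^ k * t < l x})
      (fun k => (meas _).nullMeasurableSet)
      hanti ⟨0, measure_ne_top _ _⟩
    have hempty : (⋂ k : ℕ, {x | 2 ^ k * t < l x}) = ∅ := by
      ext x
      obtain ⟨k, hk⟩ := pow_unbounded_of_one_lt (l x / t) (one_lt_two (α := ℝ))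
      refine iff_of_false (fun hx => ?_) (notMem_empty x)
      exact lt_asymm (mem_iInter.1 hx k) ((div_lt_iff₀ ht).1 hk)
    rw [hempty, measure_empty] at hlim
    exact le_antisymm (ge_of_tendsto' hlim (iter t ht)) zero_le
  have : {x | ¬ l x ≤ 0} = ⋃ n : ℕ, {x | 1 / ((n : ℝ) + 1) < l x} := by
    ext x
    refine Iff.trans (b := 0 < l x) not_le (Iff.trans ?_ mem_iUnion.symm)
    exact ⟨fun h => exists_nat_one_div_lt h,
      fun ⟨n, (h : 1 / ((n : ℝ) + 1) < l x)⟩ => lt_trans (by positivity) h⟩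
  rw [ae_iff, this, measure_iUnion_null_iff]
  exact fun n => zero _ (by positivity)

/-- The triangle carrying `Q`, in the coordinates `(x₁, x₂ / √3)`. -/
def Tri : Set (ℝ × ℝ) := {x | 0 ≤ x.2 ∧ x.2 ≤ x.1 ∧ x.2 ≤ 1 - x.1}

lemma SelfSim.ae_mem [IsProbabilityMeasure Q] (hQ : SelfSim Q) : ∀ᵐ x ∂Q, x ∈ Tri := by
  have a1 := hQ.ae_nonpos (l := fun x => -x.2) (by fun_prop)
    (fun x h => by simp only [T₁] at h ⊢; linarith)
    (fun x h => by simp only [T₂] at h ⊢; linarith)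
    (fun x h => by simp only [T₃] at h ⊢; linarith)
  have a2 := hQ.ae_nonpos (l := fun x => x.2 - x.1) (by fun_prop)
    (fun x h => by simp only [T₁] at h ⊢; linarith)
    (fun x h => by simp only [T₂] at h ⊢; linarith)
    (fun x h => by simp only [T₃] at h ⊢; linarith)
  have a3 := hQ.ae_nonpos (l := fun x => x.2 + x.1 - 1) (by fun_prop)
    (fun x h => by simp only [T₁] at h ⊢; linarith)
    (fun x h => by simp only [T₂] at h ⊢; linarith)
    (fun x h => by simp only [T₃] at h ⊢; linarith)
  filter_upwards [a1, a2, a3] with x h1 h2 h3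
  exact ⟨by linarith, by linarith, by linarith⟩

lemma SelfSim.integrable_of_continuous [IsProbabilityMeasure Q] (hQ : SelfSim Q)
    {g : ℝ × ℝ → ℝ} (hg : Continuous g) : Integrable g Q := by
  have hsub : Tri ⊆ Icc (0 : ℝ × ℝ) (1, 1) := fun x ⟨h1, h2, h3⟩ =>
    ⟨⟨by simp only [Prod.fst_zero]; linarith, h1⟩,
      ⟨by simp only []; linarith, by simp only []; linarith⟩⟩
  obtain ⟨C, hC⟩ := (isCompact_Icc (a := (0 : ℝ × ℝ)) (b := (1, 1))).exists_bound_of_continuousOn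
    hg.continuousOn
  refine Integrable.of_bound hg.aestronglyMeasurable C ?_
  filter_upwards [hQ.ae_mem] with x hx using hC x (hsub hx)

variable [IsProbabilityMeasure Q]

lemma SelfSim.integral_fst (hQ : SelfSim Q) : ∫ x, x.1 ∂Q = 1/2 := by
  have h := hQ.integral_eq (hQ.integrable_of_continuous continuous_fst)
  have i := hQ.integrable_of_continuous continuous_fst
  simp only [T₁, T₂, T₃] at h
  rw [integral_add (i.div_const _) (integrable_const _),
    integral_add (i.div_const _) (integrable_const _)] at h
  simp only [integral_div, integral_const, probReal_univ, smul_eq_mul] at h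
  linarith

lemma SelfSim.integral_snd (hQ : SelfSim Q) : ∫ x, x.2 ∂Q = 1/4 := by
  have h := hQ.integral_eq (hQ.integrable_of_continuous continuous_snd)
  have i := hQ.integrable_of_continuous continuous_snd
  simp only [T₁, T₂, T₃] at h
  rw [integral_add (i.div_const _) (integrable_const _)] at h
  simp only [integral_div, integral_const, probReal_univ, smul_eq_mul] at h
  linarith

lemma SelfSim.integral_affine (hQ : SelfSim Q) (α β γ : ℝ) :
    ∫ x, (α + β * x.1 + γ * x.2) ∂Q = α + β / 2 + γ / 4 := by
  have i1 := (hQ.integrable_of_continuous continuous_fst).const_mul β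
  have i2 := (hQ.integrable_of_continuous continuous_snd).const_mul γ
  have i0 : Integrable (fun x : ℝ × ℝ => α + β * x.1) Q :=
    hQ.integrable_of_continuous (by fun_prop)
  rw [integral_add i0 i2, integral_add (integrable_const α) i1,
    integral_const_mul, integral_const_mul, hQ.integral_fst, hQ.integral_snd]
  simp only [integral_const, probReal_univ, smul_eq_mul]
  ring

/-- The squared Euclidean distance in the coordinates `(x₁, x₂ / √3)`. -/
def hd (x c : ℝ × ℝ) : ℝ := (x.1 - c.1) ^ 2 + 3 * (x.2 - c.2) ^ 2

lemma hd_nonneg (x c : ℝ × ℝ) : 0 ≤ hd x c := by unfold hd; positivity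

lemma continuous_hd (c : ℝ × ℝ) : Continuous (fun x => hd x c) := by unfold hd; fun_prop

lemma hd_T₁ (x c : ℝ × ℝ) : hd (T₁ x) c = hd x (R₁ c) / 16 := by simp only [hd, T₁, R₁]; ring
lemma hd_T₂ (x c : ℝ × ℝ) : hd (T₂ x) c = hd x (R₂ c) / 16 := by simp only [hd, T₂, R₂]; ring
lemma hd_T₃ (x c : ℝ × ℝ) : hd (T₃ x) c = hd x (R₃ c) / 4 := by simp only [hd, T₃, R₃]; ring

lemma SelfSim.integrable_hd (hQ : SelfSim Q) (c : ℝ × ℝ) : Integrable (fun x => hd x c) Q :=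
  hQ.integrable_of_continuous (continuous_hd c)

lemma SelfSim.integral_hd_sub (hQ : SelfSim Q) (c : ℝ × ℝ) :
    ∫ x, hd x c ∂Q = ∫ x, hd x (1/2, 1/4) ∂Q + hd (1/2, 1/4) c := by
  have e : ∀ x : ℝ × ℝ, hd x c = hd x (1/2, 1/4) + ((c.1 ^ 2 + 3 * c.2 ^ 2 - 7 / 16)
      + (1 - 2 * c.1) * x.1 + (3 / 2 - 6 * c.2) * x.2) := by
    intro x; simp only [hd]; ring
  rw [integral_congr_ae (ae_of_all _ e), integral_add (hQ.integrable_hd _)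
    (hQ.integrable_of_continuous (by fun_prop)), hQ.integral_affine]
  simp only [hd]
  ring

lemma SelfSim.integral_hd_center (hQ : SelfSim Q) : ∫ x, hd x (1/2, 1/4) ∂Q = 27/176 := by
  have h := hQ.integral_eq (hQ.integrable_hd (1/2, 1/4))
  simp only [hd_T₁, hd_T₂, hd_T₃, integral_div] at h
  rw [hQ.integral_hd_sub (R₁ _), hQ.integral_hd_sub (R₂ _), hQ.integral_hd_sub (R₃ _)] at h
  simp only [R₁, R₂, R₃] at h
  have k1 : hd (1/2, 1/4) (4 * (1/2), 4 * (1/4)) = 63/16 := by norm_num [hd]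
  have k2 : hd (1/2, 1/4) (4 * (1/2) - 3, 4 * (1/4)) = 63/16 := by norm_num [hd]
  have k3 : hd (1/2, 1/4) (2 * (1/2) - 1/2, 2 * (1/4) - 1/2) = 3/16 := by norm_num [hd]
  rw [k1, k2, k3] at h
  linarith

lemma SelfSim.integral_hd (hQ : SelfSim Q) (c : ℝ × ℝ) :
    ∫ x, hd x c ∂Q = 27/176 + hd (1/2, 1/4) c := by
  rw [hQ.integral_hd_sub, hQ.integral_hd_center]

end

/-- The distortion error in the coordinates `(x₁, x₂ / √3)`. -/
noncomputable def distor (Q : Measure (ℝ × ℝ)) (α : Set (ℝ × ℝ)) : ℝ :=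
  ∫ x, sInf ((fun c => hd x c) '' α) ∂Q

/-- The quantization error in the coordinates `(x₁, x₂ / √3)`. -/
noncomputable def qe (Q : Measure (ℝ × ℝ)) (n : ℕ) : ℝ :=
  sInf { v | ∃ α : Set (ℝ × ℝ), 1 ≤ α.encard ∧ α.encard ≤ (n : ℕ∞) ∧ v = distor Q α }

/-- The total amount by which the price `f` exceeds the squared distance to `c`. -/
noncomputable def excess (Q : Measure (ℝ × ℝ)) (f : ℝ × ℝ → ℝ) (c : ℝ × ℝ) : ℝ :=
  ∫ x, max (f x - hd x c) 0 ∂Q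

/-- The points `a(ω)` and `a(ω1, ω2)` in the coordinates `(x₁, x₂ / √3)`. -/
inductive Canon : ℝ × ℝ → Prop
  | center : Canon (1/2, 1/4)
  | base : Canon (1/2, 1/16)
  | T₁ {c} : Canon c → Canon (T₁ c)
  | T₂ {c} : Canon c → Canon (T₂ c)
  | T₃ {c} : Canon c → Canon (T₃ c)

/-- The distance of `x` to the lower left vertex of the triangle, along the left edge. -/
noncomputable def left (x : ℝ × ℝ) : ℝ := x.1 / 2 + 3 * x.2 / 2

/-- The distance of `x` to the lower right vertex of the triangle, along the right edge. -/
noncomputable def right (x : ℝ × ℝ) : ℝ := (1 - x.1) / 2 + 3 * x.2 / 2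

/-- Bounds on the radius `√t` of the region served from `x` at price `t`. -/
structure Reach (r : ℝ) (x : ℝ × ℝ) (t : ℝ) : Prop where
  left_lower : t ≤ (r + left x) ^ 2
  right_lower : t ≤ (r + right x) ^ 2
  left_upper : t ≤ (387/256 - left x) ^ 2
  right_upper : t ≤ (387/256 - right x) ^ 2
  fst_lower : t ≤ (1 + x.1) ^ 2
  fst_upper : t ≤ (2 - x.1) ^ 2

/-- A dual certificate for the quantization problem with cost `l` per point. -/
structure Cert (Q : Measure (ℝ × ℝ)) (r l : ℝ) (f : ℝ × ℝ → ℝ) : Prop where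
  integrable : Integrable f Q
  excess_le : ∀ c, excess Q f c ≤ l
  canon : ∀ c, excess Q f c = l → Canon c
  reach : ∀ᵐ x ∂Q, Reach r x (f x)

/-- Sets of `n`-means are optimal at cost `l` per point, as witnessed by a certificate. -/
def Tight (Q : Measure (ℝ × ℝ)) (r l : ℝ) (n : ℕ) : Prop :=
  ∃ f, Cert Q r l f ∧ qe Q n + l * n ≤ ∫ x, f x ∂Q

section
variable {Q : Measure (ℝ × ℝ)}

lemma finite_of_encard_le {α : Set (ℝ × ℝ)} {n : ℕ} (h : α.encard ≤ (n : ℕ∞)) : α.Finite :=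
  finite_of_encard_le_coe h

lemma nonempty_of_one_le_encard {α : Set (ℝ × ℝ)} (h : 1 ≤ α.encard) : α.Nonempty :=
  one_le_encard_iff_nonempty.1 h

lemma bddBelow_hd (x : ℝ × ℝ) (α : Set (ℝ × ℝ)) : BddBelow ((fun c => hd x c) '' α) :=
  ⟨0, by rintro _ ⟨c, -, rfl⟩; exact hd_nonneg x c⟩

lemma sInf_hd_nonneg (x : ℝ × ℝ) (α : Set (ℝ × ℝ)) : 0 ≤ sInf ((fun c => hd x c) '' α) :=
  Real.sInf_nonneg (by rintro _ ⟨c, -, rfl⟩; exact hd_nonneg x c)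

lemma sInf_hd_le (x : ℝ × ℝ) {α : Set (ℝ × ℝ)} {c : ℝ × ℝ} (hc : c ∈ α) :
    sInf ((fun c => hd x c) '' α) ≤ hd x c :=
  csInf_le (bddBelow_hd x α) (mem_image_of_mem _ hc)

lemma measurable_sInf_hd {α : Set (ℝ × ℝ)} (hα : α.Finite) :
    Measurable fun x => sInf ((fun c => hd x c) '' α) := by
  have := hα.countable.to_subtype
  simp_rw [sInf_image']
  exact Measurable.iInf fun c => (continuous_hd c).measurable

lemma bddBelow_qe (n : ℕ) : BddBelow { v | ∃ α : Set (ℝ × ℝ), 1 ≤ α.encard ∧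
    α.encard ≤ (n : ℕ∞) ∧ v = distor Q α } :=
  ⟨0, by rintro _ ⟨α, -, -, rfl⟩; exact integral_nonneg fun x => sInf_hd_nonneg x α⟩

lemma qe_le {n : ℕ} {α : Set (ℝ × ℝ)} (h1 : 1 ≤ α.encard) (hn : α.encard ≤ (n : ℕ∞)) :
    qe Q n ≤ distor Q α := csInf_le (bddBelow_qe n) ⟨α, h1, hn, rfl⟩

lemma exists_distor_lt {n : ℕ} (hn : 1 ≤ n) {t : ℝ} (ht : qe Q n < t) :
    ∃ α : Set (ℝ × ℝ), 1 ≤ α.encard ∧ α.encard ≤ (n : ℕ∞) ∧ distor Q α < t := by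
  obtain ⟨_, ⟨α, h1, h2, rfl⟩, h⟩ := exists_lt_of_csInf_lt
    (by exact ⟨_, {(0, 0)}, by simp, by simpa using hn, rfl⟩) ht
  exact ⟨α, h1, h2, h⟩

variable [IsProbabilityMeasure Q]

lemma SelfSim.integrable_sInf_hd (hQ : SelfSim Q) {α : Set (ℝ × ℝ)} (hα : α.Finite)
    (hne : α.Nonempty) : Integrable (fun x => sInf ((fun c => hd x c) '' α)) Q := by
  obtain ⟨c, hc⟩ := hne
  refine (hQ.integrable_hd c).mono' (measurable_sInf_hd hα).aestronglyMeasurable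
    (ae_of_all _ fun x => ?_)
  rw [Real.norm_of_nonneg (sInf_hd_nonneg x α)]
  exact sInf_hd_le x hc

lemma SelfSim.integrable_excess (hQ : SelfSim Q) {f : ℝ × ℝ → ℝ} (hf : Integrable f Q)
    (c : ℝ × ℝ) : Integrable (fun x => max (f x - hd x c) 0) Q :=
  (hf.sub (hQ.integrable_hd c)).pos_part

lemma SelfSim.integral_le_distor (hQ : SelfSim Q) {f : ℝ × ℝ → ℝ} (hf : Integrable f Q)
    (s : Finset (ℝ × ℝ)) (hs : s.Nonempty) :
    ∫ x, f x ∂Q ≤ distor Q s + ∑ c ∈ s, excess Q f c := by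
  have hi := hQ.integrable_sInf_hd s.finite_toSet hs.to_set
  unfold distor excess
  rw [← integral_finsetSum _ fun c _ => hQ.integrable_excess hf c,
    ← integral_add hi (integrable_finsetSum _ fun c _ => hQ.integrable_excess hf c)]
  refine integral_mono hf (hi.add (integrable_finsetSum _ fun c _ => hQ.integrable_excess hf c))
    fun x => ?_
  obtain ⟨c, hc, e⟩ := ((s.finite_toSet.image fun c => hd x c)).isCompact.sInf_mem
    (hs.to_set.image _)
  have h1 := Finset.single_le_sum (f := fun c => max (f x - hd x c) 0)
    (fun c _ => le_max_right _ _) (Finset.mem_coe.1 hc)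
  have h2 := le_max_left (f x - hd x c) 0
  simp only at e h1
  rw [← e]
  linarith

lemma Cert.le_distor {r l : ℝ} {f : ℝ × ℝ → ℝ} (hQ : SelfSim Q) (hf : Cert Q r l f)
    (hl : 0 ≤ l) {n : ℕ} {α : Set (ℝ × ℝ)} (h1 : 1 ≤ α.encard) (hn : α.encard ≤ (n : ℕ∞)) :
    ∫ x, f x ∂Q ≤ distor Q α + l * n := by
  obtain ⟨s, rfl⟩ := (finite_of_encard_le hn).exists_finset_coe
  have h := hQ.integral_le_distor hf.integrable s (nonempty_of_one_le_encard h1)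
  have hs := Finset.sum_le_card_nsmul s (excess Q f) l fun c _ => hf.excess_le c
  rw [encard_coe_eq_coe_finsetCard, Nat.cast_le] at hn
  rw [nsmul_eq_mul] at hs
  have : (s.card : ℝ) ≤ n := by exact_mod_cast hn
  nlinarith

lemma Cert.le_qe {r l : ℝ} {f : ℝ × ℝ → ℝ} (hQ : SelfSim Q) (hf : Cert Q r l f)
    (hl : 0 ≤ l) {n : ℕ} (hn : 1 ≤ n) : ∫ x, f x ∂Q ≤ qe Q n + l * n := by
  by_contra! h
  obtain ⟨α, h1, h2, h3⟩ := exists_distor_lt hn (lt_sub_iff_add_lt.2 h)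
  linarith [hf.le_distor hQ hl h1 h2]

lemma Tight.canon {r l : ℝ} {n : ℕ} (hQ : SelfSim Q) (h : Tight Q r l n) (hl : 0 ≤ l)
    {α : Set (ℝ × ℝ)} (h1 : 1 ≤ α.encard) (hn : α.encard ≤ (n : ℕ∞))
    (hα : distor Q α = qe Q n) {c : ℝ × ℝ} (hc : c ∈ α) : Canon c := by
  obtain ⟨f, hf, hF⟩ := h
  obtain ⟨s, rfl⟩ := (finite_of_encard_le hn).exists_finset_coe
  refine hf.canon c (le_antisymm (hf.excess_le c) ?_)
  have h := hQ.integral_le_distor hf.integrable s (nonempty_of_one_le_encard h1)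
  rw [← Finset.add_sum_erase s _ (Finset.mem_coe.1 hc)] at h
  have hs := Finset.sum_le_card_nsmul (s.erase c) (excess Q f) l fun c _ => hf.excess_le c
  have hcard := Finset.card_erase_add_one (Finset.mem_coe.1 hc)
  rw [encard_coe_eq_coe_finsetCard, Nat.cast_le] at hn
  rw [nsmul_eq_mul] at hs
  have : ((s.erase c).card : ℝ) + 1 ≤ n := by exact_mod_cast hcard.trans_le hn
  nlinarith

lemma Tight.le {r l : ℝ} {m n : ℕ} (hQ : SelfSim Q) (h : Tight Q r l m) (hl : 0 ≤ l)
    (hn : 1 ≤ n) : qe Q m + l * m ≤ qe Q n + l * n := by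
  obtain ⟨f, hf, hF⟩ := h
  exact hF.trans (hf.le_qe hQ hl hn)

lemma Reach.convex {r : ℝ} {x : ℝ × ℝ} {s t a b : ℝ} (hs : Reach r x s) (ht : Reach r x t)
    (ha : 0 ≤ a) (hb : 0 ≤ b) (hab : a + b = 1) : Reach r x (a * s + b * t) := by
  have key : ∀ {z : ℝ}, s ≤ z → t ≤ z → a * s + b * t ≤ z := fun {z} h1 h2 =>
    calc a * s + b * t ≤ a * z + b * z := by gcongr
      _ = z := by rw [← add_mul, hab, one_mul]
  exact ⟨key hs.1 ht.1, key hs.2 ht.2, key hs.3 ht.3, key hs.4 ht.4, key hs.5 ht.5,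
    key hs.6 ht.6⟩

lemma Cert.convex {r l m a b : ℝ} {f g : ℝ × ℝ → ℝ} (hQ : SelfSim Q) (hf : Cert Q r l f)
    (hg : Cert Q r m g) (ha : 0 < a) (hb : 0 ≤ b) (hab : a + b = 1) :
    Cert Q r (a * l + b * m) fun x => a * f x + b * g x := by
  have hi : Integrable (fun x => a * f x + b * g x) Q :=
    (hf.integrable.const_mul a).add (hg.integrable.const_mul b)
  have key : ∀ c, excess Q (fun x => a * f x + b * g x) c
      ≤ a * excess Q f c + b * excess Q g c := by
    intro c
    unfold excess
    rw [← integral_const_mul, ← integral_const_mul, ← integral_add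
      ((hQ.integrable_excess hf.integrable c).const_mul a)
      ((hQ.integrable_excess hg.integrable c).const_mul b)]
    refine integral_mono (hQ.integrable_excess hi c)
      (((hQ.integrable_excess hf.integrable c).const_mul a).add
      ((hQ.integrable_excess hg.integrable c).const_mul b)) fun x => ?_
    have h1 := mul_le_mul_of_nonneg_left (le_max_left (f x - hd x c) 0) ha.le
    have h2 := mul_le_mul_of_nonneg_left (le_max_left (g x - hd x c) 0) hb
    have h3 := mul_le_mul_of_nonneg_left (le_max_right (f x - hd x c) 0) ha.le
    have h4 := mul_le_mul_of_nonneg_left (le_max_right (g x - hd x c) 0) hb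
    refine max_le ?_ (by linarith)
    have : (a + b) * hd x c = hd x c := by rw [hab, one_mul]
    linarith
  refine ⟨hi, fun c => ?_, fun c hc => ?_, ?_⟩
  · have := mul_le_mul_of_nonneg_left (hf.excess_le c) ha.le
    have := mul_le_mul_of_nonneg_left (hg.excess_le c) hb
    linarith [key c]
  · refine hf.canon c (le_antisymm (hf.excess_le c) ?_)
    have := mul_le_mul_of_nonneg_left (hg.excess_le c) hb
    have := key c
    exact le_of_mul_le_mul_left (by linarith) ha
  · filter_upwards [hf.reach, hg.reach] with x h1 h2 using h1.convex h2 ha.le hb hab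

lemma Tight.convex {r l m t : ℝ} {n : ℕ} (hQ : SelfSim Q) (hl : Tight Q r l n)
    (hm : Tight Q r m n) (h1 : l ≤ t) (h2 : t ≤ m) : Tight Q r t n := by
  rcases h2.eq_or_lt with rfl | h2
  · exact hm
  obtain ⟨f, hf, hF⟩ := hl
  obtain ⟨g, hg, hG⟩ := hm
  have hlm : 0 < m - l := by linarith
  have ha : 0 < (m - t) / (m - l) := div_pos (by linarith) hlm
  have hb : 0 ≤ (t - l) / (m - l) := div_nonneg (by linarith) hlm.le
  have hab : (m - t) / (m - l) + (t - l) / (m - l) = 1 := by field_simp; ring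
  have ht : t = (m - t) / (m - l) * l + (t - l) / (m - l) * m := by field_simp; ring
  refine ⟨_, by rw [ht]; exact hf.convex hQ hg ha hb hab, ?_⟩
  rw [integral_add (hf.integrable.const_mul _) (hg.integrable.const_mul _),
    integral_const_mul, integral_const_mul]
  have h3 := mul_le_mul_of_nonneg_left hF ha.le
  have h4 := mul_le_mul_of_nonneg_left hG hb
  have h5 : qe Q n + t * n = (m - t) / (m - l) * (qe Q n + l * n)
      + (t - l) / (m - l) * (qe Q n + m * n) := by
    field_simp; ring
  linarith

end

section
variable {Q : Measure (ℝ × ℝ)}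

lemma SelfSim.ae_of_comp (hQ : SelfSim Q) {p : ℝ × ℝ → Prop} (h1 : ∀ᵐ x ∂Q, p (T₁ x))
    (h2 : ∀ᵐ x ∂Q, p (T₂ x)) (h3 : ∀ᵐ x ∂Q, p (T₃ x)) : ∀ᵐ x ∂Q, p x := by
  rw [hQ, ae_add_measure_iff, ae_add_measure_iff]
  exact ⟨⟨Measure.ae_smul_measure (emb_T₁.ae_map_iff.2 h1) _,
    Measure.ae_smul_measure (emb_T₂.ae_map_iff.2 h2) _⟩,
    Measure.ae_smul_measure (emb_T₃.ae_map_iff.2 h3) _⟩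

/-- The price function made of rescaled copies of `f₁`, `f₂`, `f₃` on the three pieces. -/
noncomputable def comb (f₁ f₂ f₃ : ℝ × ℝ → ℝ) (x : ℝ × ℝ) : ℝ :=
  if 1/4 ≤ x.2 then f₃ (R₃ x) / 4
  else if x.1 < 1/2 then f₁ (R₁ x) / 16 else f₂ (R₂ x) / 16

end

section
variable {Q : Measure (ℝ × ℝ)} [IsProbabilityMeasure Q]

variable {f₁ f₂ f₃ : ℝ × ℝ → ℝ}

lemma comb_T₁ {x : ℝ × ℝ} (hx : x ∈ Tri) : comb f₁ f₂ f₃ (T₁ x) = f₁ x / 16 := by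
  obtain ⟨h1, h2, h3⟩ := hx
  have e1 : ¬ 1/4 ≤ (T₁ x).2 := by simp only [T₁]; linarith
  have e2 : (T₁ x).1 < 1/2 := by simp only [T₁]; linarith
  rw [comb, if_neg e1, if_pos e2, R₁_T₁]

lemma comb_T₂ {x : ℝ × ℝ} (hx : x ∈ Tri) : comb f₁ f₂ f₃ (T₂ x) = f₂ x / 16 := by
  obtain ⟨h1, h2, h3⟩ := hx
  have e1 : ¬ 1/4 ≤ (T₂ x).2 := by simp only [T₂]; linarith
  have e2 : ¬ (T₂ x).1 < 1/2 := by simp only [T₂]; linarith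
  rw [comb, if_neg e1, if_neg e2, R₂_T₂]

lemma comb_T₃ {x : ℝ × ℝ} (hx : x ∈ Tri) : comb f₁ f₂ f₃ (T₃ x) = f₃ x / 4 := by
  obtain ⟨h1, h2, h3⟩ := hx
  have e1 : 1/4 ≤ (T₃ x).2 := by simp only [T₃]; linarith
  rw [comb, if_pos e1, R₃_T₃]

lemma SelfSim.ae_comb_T₁ (hQ : SelfSim Q) : ∀ᵐ x ∂Q, comb f₁ f₂ f₃ (T₁ x) = f₁ x / 16 :=
  hQ.ae_mem.mono fun _ => comb_T₁

lemma SelfSim.ae_comb_T₂ (hQ : SelfSim Q) : ∀ᵐ x ∂Q, comb f₁ f₂ f₃ (T₂ x) = f₂ x / 16 :=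
  hQ.ae_mem.mono fun _ => comb_T₂

lemma SelfSim.ae_comb_T₃ (hQ : SelfSim Q) : ∀ᵐ x ∂Q, comb f₁ f₂ f₃ (T₃ x) = f₃ x / 4 :=
  hQ.ae_mem.mono fun _ => comb_T₃

lemma SelfSim.integrable_comb (hQ : SelfSim Q) (h1 : Integrable f₁ Q) (h2 : Integrable f₂ Q)
    (h3 : Integrable f₃ Q) : Integrable (comb f₁ f₂ f₃) Q :=
  hQ.integrable_iff.2 ⟨(h1.div_const 16).congr (hQ.ae_comb_T₁.mono fun _ h => h.symm),
    (h2.div_const 16).congr (hQ.ae_comb_T₂.mono fun _ h => h.symm),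
    (h3.div_const 4).congr (hQ.ae_comb_T₃.mono fun _ h => h.symm)⟩

lemma SelfSim.integral_comb (hQ : SelfSim Q) (h1 : Integrable f₁ Q) (h2 : Integrable f₂ Q)
    (h3 : Integrable f₃ Q) : ∫ x, comb f₁ f₂ f₃ x ∂Q
      = (∫ x, f₁ x ∂Q + ∫ x, f₂ x ∂Q) / 80 + 3/20 * ∫ x, f₃ x ∂Q := by
  rw [hQ.integral_eq (hQ.integrable_comb h1 h2 h3), integral_congr_ae hQ.ae_comb_T₁,
    integral_congr_ae hQ.ae_comb_T₂, integral_congr_ae hQ.ae_comb_T₃, integral_div,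
    integral_div, integral_div]
  ring

lemma max_div_sub (a b : ℝ) {k : ℝ} (hk : 0 ≤ k) :
    max (a / k - b / k) 0 = max (a - b) 0 / k := by
  rw [← sub_div, ← max_div_div_right hk, zero_div]

lemma SelfSim.excess_comb (hQ : SelfSim Q) (h1 : Integrable f₁ Q) (h2 : Integrable f₂ Q)
    (h3 : Integrable f₃ Q) (c : ℝ × ℝ) : excess Q (comb f₁ f₂ f₃) c
      = (excess Q f₁ (R₁ c) + excess Q f₂ (R₂ c)) / 80 + 3/20 * excess Q f₃ (R₃ c) := by
  have e1 : ∀ᵐ x ∂Q, max (comb f₁ f₂ f₃ (T₁ x) - hd (T₁ x) c) 0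
      = max (f₁ x - hd x (R₁ c)) 0 / 16 := hQ.ae_comb_T₁.mono fun x h => by
    rw [h, hd_T₁, max_div_sub _ _ (by norm_num)]
  have e2 : ∀ᵐ x ∂Q, max (comb f₁ f₂ f₃ (T₂ x) - hd (T₂ x) c) 0
      = max (f₂ x - hd x (R₂ c)) 0 / 16 := hQ.ae_comb_T₂.mono fun x h => by
    rw [h, hd_T₂, max_div_sub _ _ (by norm_num)]
  have e3 : ∀ᵐ x ∂Q, max (comb f₁ f₂ f₃ (T₃ x) - hd (T₃ x) c) 0
      = max (f₃ x - hd x (R₃ c)) 0 / 4 := hQ.ae_comb_T₃.mono fun x h => by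
    rw [h, hd_T₃, max_div_sub _ _ (by norm_num)]
  unfold excess
  rw [hQ.integral_eq (hQ.integrable_excess (hQ.integrable_comb h1 h2 h3) c),
    integral_congr_ae e1, integral_congr_ae e2, integral_congr_ae e3, integral_div,
    integral_div, integral_div]
  ring

lemma Tri.left_nonneg {x : ℝ × ℝ} (hx : x ∈ Tri) : 0 ≤ left x := by
  obtain ⟨h1, h2, h3⟩ := hx; unfold left; linarith

lemma Tri.left_le {x : ℝ × ℝ} (hx : x ∈ Tri) : left x ≤ 1 := by
  obtain ⟨h1, h2, h3⟩ := hx; unfold left; linarith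

lemma Tri.right_nonneg {x : ℝ × ℝ} (hx : x ∈ Tri) : 0 ≤ right x := by
  obtain ⟨h1, h2, h3⟩ := hx; unfold right; linarith

lemma Tri.right_le {x : ℝ × ℝ} (hx : x ∈ Tri) : right x ≤ 1 := by
  obtain ⟨h1, h2, h3⟩ := hx; unfold right; linarith

lemma Tri.fst_nonneg {x : ℝ × ℝ} (hx : x ∈ Tri) : 0 ≤ x.1 := by
  obtain ⟨h1, h2, h3⟩ := hx; linarith

lemma Tri.fst_le {x : ℝ × ℝ} (hx : x ∈ Tri) : x.1 ≤ 1 := by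
  obtain ⟨h1, h2, h3⟩ := hx; linarith

lemma abs_fst_sub_le (x c : ℝ × ℝ) : (x.1 - c.1) ^ 2 ≤ hd x c := by
  unfold hd; nlinarith [sq_nonneg (x.2 - c.2)]

lemma abs_left_sub_le (x c : ℝ × ℝ) : (left x - left c) ^ 2 ≤ hd x c := by
  unfold hd left; nlinarith [sq_nonneg ((x.1 - c.1) - (x.2 - c.2))]

lemma abs_right_sub_le (x c : ℝ × ℝ) : (right x - right c) ^ 2 ≤ hd x c := by
  unfold hd right; nlinarith [sq_nonneg ((x.1 - c.1) + (x.2 - c.2))]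

/-- The region where a certificate with parameter `r` can have positive excess. -/
structure Zone (r : ℝ) (c : ℝ × ℝ) : Prop where
  left_lower : - r < left c
  right_lower : - r < right c
  left_upper : left c < 387/256
  right_upper : right c < 387/256
  fst_lower : -1 < c.1
  fst_upper : c.1 < 2

lemma Reach.zone {r t : ℝ} {x c : ℝ × ℝ} (hr : 0 ≤ r) (hx : x ∈ Tri) (h : Reach r x t)
    (hc : hd x c < t) : Zone r c := by
  have hl := Tri.left_nonneg hx
  have hr := Tri.right_nonneg hx
  have hl' := Tri.left_le hx
  have hr' := Tri.right_le hx
  have h0 := Tri.fst_nonneg hx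
  have h1 := Tri.fst_le hx
  have kl := abs_left_sub_le x c
  have kr := abs_right_sub_le x c
  have kf := abs_fst_sub_le x c
  refine ⟨?_, ?_, ?_, ?_, ?_, ?_⟩
  · linarith [(abs_lt_of_sq_lt_sq' ((kl.trans_lt hc).trans_le h.left_lower) (by linarith)).2]
  · linarith [(abs_lt_of_sq_lt_sq' ((kr.trans_lt hc).trans_le h.right_lower) (by linarith)).2]
  · linarith [(abs_lt_of_sq_lt_sq' ((kl.trans_lt hc).trans_le h.left_upper) (by linarith)).1]
  · linarith [(abs_lt_of_sq_lt_sq' ((kr.trans_lt hc).trans_le h.right_upper) (by linarith)).1]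
  · linarith [(abs_lt_of_sq_lt_sq' ((kf.trans_lt hc).trans_le h.fst_lower) (by linarith)).2]
  · linarith [(abs_lt_of_sq_lt_sq' ((kf.trans_lt hc).trans_le h.fst_upper) (by linarith)).1]

lemma Cert.zone {r l : ℝ} {f : ℝ × ℝ → ℝ} {c : ℝ × ℝ} (hQ : SelfSim Q) (hf : Cert Q r l f)
    (hr : 0 ≤ r) (hc : excess Q f c ≠ 0) : Zone r c := by
  by_contra hz
  refine hc ((integral_congr_ae ?_).trans (integral_zero _ _))
  filter_upwards [hQ.ae_mem, hf.reach] with x hx h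
  refine max_eq_right (sub_nonpos.2 (le_of_not_gt fun hlt => hz (h.zone hr hx hlt)))

lemma Reach.mono {r s t : ℝ} {x : ℝ × ℝ} (hr : 0 ≤ r) (hrs : r ≤ s) (hx : x ∈ Tri)
    (h : Reach r x t) : Reach s x t where
  left_lower := h.left_lower.trans (pow_le_pow_left₀
    (add_nonneg hr (Tri.left_nonneg hx)) (by linarith) 2)
  right_lower := h.right_lower.trans (pow_le_pow_left₀
    (add_nonneg hr (Tri.right_nonneg hx)) (by linarith) 2)
  left_upper := h.left_upper
  right_upper := h.right_upper
  fst_lower := h.fst_lower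
  fst_upper := h.fst_upper

lemma Tight.mono {r s l : ℝ} {n : ℕ} (hQ : SelfSim Q) (h : Tight Q r l n) (hr : 0 ≤ r)
    (hrs : r ≤ s) : Tight Q s l n := by
  obtain ⟨f, hf, hF⟩ := h
  refine ⟨f, ⟨hf.integrable, hf.excess_le, hf.canon, ?_⟩, hF⟩
  filter_upwards [hQ.ae_mem, hf.reach] with x hx h using h.mono hr hrs hx

lemma div_le_sq_of_le {t a b k : ℝ} (hk : 0 < k) (h : t ≤ a ^ 2) (ha : 0 ≤ a) (hab : a ≤ k * b) :
    t / k ^ 2 ≤ b ^ 2 := by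
  rw [div_le_iff₀ (by positivity), ← mul_pow, mul_comm]
  exact h.trans (pow_le_pow_left₀ ha hab 2)

lemma Reach.comp_T₁ {t : ℝ} {x : ℝ × ℝ} (hx : x ∈ Tri) (h : Reach (125/128) x t) :
    Reach (125/512) (T₁ x) (t / 16) := by
  have hl := Tri.left_nonneg hx
  have hr := Tri.right_nonneg hx
  have hl' := Tri.left_le hx
  have hr' := Tri.right_le hx
  have h0 := Tri.fst_nonneg hx
  have h1 := Tri.fst_le hx
  have e1 : left (T₁ x) = left x / 4 := by unfold left T₁; ring
  have e2 : right (T₁ x) = right x / 4 + 3/8 := by unfold right T₁; ring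
  have e3 : (T₁ x).1 = x.1 / 4 := rfl
  rw [show (16 : ℝ) = 4 ^ 2 by norm_num]
  constructor
  · exact div_le_sq_of_le four_pos h.left_lower (by linarith) (by linarith)
  · exact div_le_sq_of_le four_pos h.right_lower (by linarith) (by linarith)
  · exact div_le_sq_of_le four_pos h.left_upper (by linarith) (by linarith)
  · exact div_le_sq_of_le four_pos h.right_upper (by linarith) (by linarith)
  · exact div_le_sq_of_le four_pos h.fst_lower (by linarith) (by linarith)
  · exact div_le_sq_of_le four_pos h.fst_upper (by linarith) (by linarith)

lemma Reach.comp_T₂ {t : ℝ} {x : ℝ × ℝ} (hx : x ∈ Tri) (h : Reach (125/128) x t) :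
    Reach (125/512) (T₂ x) (t / 16) := by
  have hl := Tri.left_nonneg hx
  have hr := Tri.right_nonneg hx
  have hl' := Tri.left_le hx
  have hr' := Tri.right_le hx
  have h0 := Tri.fst_nonneg hx
  have h1 := Tri.fst_le hx
  have e1 : left (T₂ x) = left x / 4 + 3/8 := by unfold left T₂; ring
  have e2 : right (T₂ x) = right x / 4 := by unfold right T₂; ring
  have e3 : (T₂ x).1 = x.1 / 4 + 3/4 := rfl
  rw [show (16 : ℝ) = 4 ^ 2 by norm_num]
  constructor
  · exact div_le_sq_of_le four_pos h.left_lower (by linarith) (by linarith)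
  · exact div_le_sq_of_le four_pos h.right_lower (by linarith) (by linarith)
  · exact div_le_sq_of_le four_pos h.left_upper (by linarith) (by linarith)
  · exact div_le_sq_of_le four_pos h.right_upper (by linarith) (by linarith)
  · exact div_le_sq_of_le four_pos h.fst_lower (by linarith) (by linarith)
  · exact div_le_sq_of_le four_pos h.fst_upper (by linarith) (by linarith)

lemma Reach.comp_T₃ {t : ℝ} {x : ℝ × ℝ} (hx : x ∈ Tri) (h : Reach (125/512) x t) :
    Reach (125/512) (T₃ x) (t / 4) := by
  have hl := Tri.left_nonneg hx
  have hr := Tri.right_nonneg hx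
  have hl' := Tri.left_le hx
  have hr' := Tri.right_le hx
  have h0 := Tri.fst_nonneg hx
  have h1 := Tri.fst_le hx
  have e1 : left (T₃ x) = left x / 2 + 1/2 := by unfold left T₃; ring
  have e2 : right (T₃ x) = right x / 2 + 1/2 := by unfold right T₃; ring
  have e3 : (T₃ x).1 = x.1 / 2 + 1/4 := rfl
  rw [show (4 : ℝ) = 2 ^ 2 by norm_num]
  constructor
  · exact div_le_sq_of_le two_pos h.left_lower (by linarith) (by linarith)
  · exact div_le_sq_of_le two_pos h.right_lower (by linarith) (by linarith)
  · exact div_le_sq_of_le two_pos h.left_upper (by linarith) (by linarith)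
  · exact div_le_sq_of_le two_pos h.right_upper (by linarith) (by linarith)
  · exact div_le_sq_of_le two_pos h.fst_lower (by linarith) (by linarith)
  · exact div_le_sq_of_le two_pos h.fst_upper (by linarith) (by linarith)

lemma Zone.disjoint_left {c : ℝ × ℝ} (h1 : Zone (125/128) (R₁ c)) (h3 : Zone (125/512) (R₃ c)) :
    False := by
  have e1 : left (R₁ c) = 4 * left c := by unfold left R₁; ring
  have e3 : left (R₃ c) = 2 * left c - 1 := by unfold left R₃; ring
  linarith [h1.left_upper, h3.left_lower]

lemma Zone.disjoint_right {c : ℝ × ℝ} (h2 : Zone (125/128) (R₂ c))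
    (h3 : Zone (125/512) (R₃ c)) : False := by
  have e2 : right (R₂ c) = 4 * right c := by unfold right R₂; ring
  have e3 : right (R₃ c) = 2 * right c - 1 := by unfold right R₃; ring
  linarith [h2.right_upper, h3.right_lower]

lemma Zone.disjoint_base {c : ℝ × ℝ} (h1 : Zone (125/128) (R₁ c)) (h2 : Zone (125/128) (R₂ c)) :
    False := by
  have e1 : (R₁ c).1 = 4 * c.1 := rfl
  have e2 : (R₂ c).1 = 4 * c.1 - 3 := rfl
  linarith [h1.fst_upper, h2.fst_lower]

lemma Cert.comb {l : ℝ} (hQ : SelfSim Q) (h1 : Cert Q (125/128) (80 * l) f₁)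
    (h2 : Cert Q (125/128) (80 * l) f₂) (h3 : Cert Q (125/512) (20 * l / 3) f₃) :
    Cert Q (125/512) l (comb f₁ f₂ f₃) := by
  have hA : (0 : ℝ) ≤ 125/128 := by norm_num
  have hB : (0 : ℝ) ≤ 125/512 := by norm_num
  have key : ∀ c, excess Q (RTriangle.comb f₁ f₂ f₃) c ≤ l ∧
      (excess Q (RTriangle.comb f₁ f₂ f₃) c = l → Canon c) := by
    intro c
    rw [hQ.excess_comb h1.integrable h2.integrable h3.integrable]
    have m1 := h1.excess_le (R₁ c)
    have m2 := h2.excess_le (R₂ c)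
    have m3 := h3.excess_le (R₃ c)
    by_cases z1 : excess Q f₁ (R₁ c) = 0
    · by_cases z2 : excess Q f₂ (R₂ c) = 0
      · refine ⟨by linarith, fun e => ?_⟩
        rw [← T₃_R₃ c]
        exact (h3.canon _ (by linarith)).T₃
      · have z3 : excess Q f₃ (R₃ c) = 0 := by
          by_contra z3
          exact (h2.zone hQ hA z2).disjoint_right (h3.zone hQ hB z3)
        refine ⟨by linarith, fun e => ?_⟩
        rw [← T₂_R₂ c]
        exact (h2.canon _ (by linarith)).T₂
    · have z2 : excess Q f₂ (R₂ c) = 0 := by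
        by_contra z2
        exact (h1.zone hQ hA z1).disjoint_base (h2.zone hQ hA z2)
      have z3 : excess Q f₃ (R₃ c) = 0 := by
        by_contra z3
        exact (h1.zone hQ hA z1).disjoint_left (h3.zone hQ hB z3)
      refine ⟨by linarith, fun e => ?_⟩
      rw [← T₁_R₁ c]
      exact (h1.canon _ (by linarith)).T₁
  refine ⟨hQ.integrable_comb h1.integrable h2.integrable h3.integrable, fun c => (key c).1,
    fun c => (key c).2, hQ.ae_of_comp ?_ ?_ ?_⟩
  · filter_upwards [hQ.ae_mem, h1.reach] with x hx h
    rw [comb_T₁ hx]; exact h.comp_T₁ hx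
  · filter_upwards [hQ.ae_mem, h2.reach] with x hx h
    rw [comb_T₂ hx]; exact h.comp_T₂ hx
  · filter_upwards [hQ.ae_mem, h3.reach] with x hx h
    rw [comb_T₃ hx]; exact h.comp_T₃ hx

lemma SelfSim.distor_le (hQ : SelfSim Q) {α β γ : Set (ℝ × ℝ)} (hα : α.Finite) (hβ : β.Finite)
    (hγ : γ.Finite) (hα₀ : α.Nonempty) (hβ₀ : β.Nonempty) (hγ₀ : γ.Nonempty) :
    distor Q (T₁ '' α ∪ T₂ '' β ∪ T₃ '' γ)
      ≤ (distor Q α + distor Q β) / 80 + 3/20 * distor Q γ := by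
  have hi := hQ.integrable_sInf_hd (((hα.image T₁).union (hβ.image T₂)).union (hγ.image T₃))
    ((hα₀.image T₁).inl.inl)
  obtain ⟨i1, i2, i3⟩ := hQ.integrable_iff.1 hi
  have j1 := integral_mono i1 ((hQ.integrable_sInf_hd hα hα₀).div_const 16) fun x => by
    refine (le_div_iff₀ (by norm_num)).2 (le_csInf (hα₀.image _) ?_)
    rintro _ ⟨c, hc, rfl⟩
    have := sInf_hd_le (T₁ x) (α := T₁ '' α ∪ T₂ '' β ∪ T₃ '' γ) (c := T₁ c)
      (Or.inl (Or.inl ⟨c, hc, rfl⟩))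
    rw [hd_T₁, R₁_T₁] at this
    linarith
  have j2 := integral_mono i2 ((hQ.integrable_sInf_hd hβ hβ₀).div_const 16) fun x => by
    refine (le_div_iff₀ (by norm_num)).2 (le_csInf (hβ₀.image _) ?_)
    rintro _ ⟨c, hc, rfl⟩
    have := sInf_hd_le (T₂ x) (α := T₁ '' α ∪ T₂ '' β ∪ T₃ '' γ) (c := T₂ c)
      (Or.inl (Or.inr ⟨c, hc, rfl⟩))
    rw [hd_T₂, R₂_T₂] at this
    linarith
  have j3 := integral_mono i3 ((hQ.integrable_sInf_hd hγ hγ₀).div_const 4) fun x => by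
    refine (le_div_iff₀ (by norm_num)).2 (le_csInf (hγ₀.image _) ?_)
    rintro _ ⟨c, hc, rfl⟩
    have := sInf_hd_le (T₃ x) (α := T₁ '' α ∪ T₂ '' β ∪ T₃ '' γ) (c := T₃ c)
      (Or.inr ⟨c, hc, rfl⟩)
    rw [hd_T₃, R₃_T₃] at this
    linarith
  rw [integral_div] at j1 j2 j3
  rw [distor, hQ.integral_eq hi]
  unfold distor
  linarith

lemma SelfSim.qe_add_le (hQ : SelfSim Q) {a b c : ℕ} (ha : 1 ≤ a) (hb : 1 ≤ b) (hc : 1 ≤ c) :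
    qe Q (a + b + c) ≤ (qe Q a + qe Q b) / 80 + 3/20 * qe Q c := by
  refine le_of_forall_pos_le_add fun ε hε => ?_
  obtain ⟨α, hα, hα', hα''⟩ := exists_distor_lt ha (lt_add_of_pos_right (qe Q a) hε)
  obtain ⟨β, hβ, hβ', hβ''⟩ := exists_distor_lt hb (lt_add_of_pos_right (qe Q b) hε)
  obtain ⟨γ, hγ, hγ', hγ''⟩ := exists_distor_lt hc (lt_add_of_pos_right (qe Q c) hε)
  have h := hQ.distor_le (finite_of_encard_le hα') (finite_of_encard_le hβ')
    (finite_of_encard_le hγ') (nonempty_of_one_le_encard hα) (nonempty_of_one_le_encard hβ)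
    (nonempty_of_one_le_encard hγ)
  have h' : qe Q (a + b + c) ≤ distor Q (T₁ '' α ∪ T₂ '' β ∪ T₃ '' γ) := by
    refine qe_le ?_ ?_
    · exact one_le_encard_iff_nonempty.2 ((nonempty_of_one_le_encard hα).image _).inl.inl
    · push_cast
      refine (encard_union_le _ _).trans (add_le_add ((encard_union_le _ _).trans
        (add_le_add ?_ ?_)) ?_)
      exacts [(encard_image_le _ _).trans hα', (encard_image_le _ _).trans hβ',
        (encard_image_le _ _).trans hγ']
  linarith

lemma Tight.comb {l : ℝ} {a b c : ℕ} (hQ : SelfSim Q) (ha : 1 ≤ a) (hb : 1 ≤ b)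
    (hc : 1 ≤ c) (h1 : Tight Q (125/128) (80 * l) a) (h2 : Tight Q (125/128) (80 * l) b)
    (h3 : Tight Q (125/512) (20 * l / 3) c) : Tight Q (125/512) l (a + b + c) := by
  obtain ⟨f₁, h1, i1⟩ := h1
  obtain ⟨f₂, h2, i2⟩ := h2
  obtain ⟨f₃, h3, i3⟩ := h3
  refine ⟨_, h1.comb hQ h2 h3, ?_⟩
  rw [hQ.integral_comb h1.integrable h2.integrable h3.integrable]
  push_cast
  linarith [hQ.qe_add_le ha hb hc]

end

/-- A point mass `w` at `(x, y)` with price `n`. -/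
structure Atom where
  x : ℕ
  y : ℕ
  w : ℕ
  n : ℕ

/-- A price function: on each cylinder of the tree, the prices at the vertices. -/
inductive PTree
  | leaf (a b c : ℕ)
  | node (t₁ t₂ t₃ : PTree)

/-- The point masses of a tree, on a triangle with lower left corner `(x, y)`, side `s` and
mass `4 * w`. -/
def PTree.atoms : PTree → ℕ → ℕ → ℕ → ℕ → List Atom → List Atom
  | leaf a b c, x, y, s, w, L =>
    ⟨x, y, w, a⟩ :: ⟨x + s, y, w, b⟩ :: ⟨x + s / 2, y + s / 2, 2 * w, c⟩ :: L
  | node t₁ t₂ t₃, x, y, s, w, L =>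
    t₁.atoms x y (s / 4) (w / 5) (t₂.atoms (x + 3 * (s / 4)) y (s / 4) (w / 5)
      (t₃.atoms (x + s / 4) (y + s / 4) (s / 2) (3 * (w / 5)) L))

/-- The state of the search: moments of the active atoms, a bound for the undecided ones,
and the list of these. -/
structure Acc where
  s : ℕ
  sx : ℕ
  sy : ℕ
  p : ℕ
  q : ℕ
  ub : ℕ
  L : List Atom

/-- Truncated distance of `a` to `b`. -/
def gap (a b : ℕ) : ℕ := (a - b) + (b - a)

/-- The quadratic form `a² + 3 * b²`. -/
def qf (a b : ℕ) : ℕ := a * a + 3 * (b * b)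

/-- Sort the atoms into active, inactive and undecided ones on the box of radius `r`
around `(mx, my)`. -/
def scan (mx my r : ℕ) : List Atom → Acc → Acc
  | [], A => A
  | z :: L, A =>
    bif (qf (gap z.x mx + r) (gap z.y my + r)).ble z.n then
      scan mx my r L ⟨A.s + z.w, A.sx + z.w * z.x, A.sy + z.w * z.y, A.p + z.w * z.n,
        A.q + z.w * qf z.x z.y, A.ub, A.L⟩
    else bif z.n.ble (qf (gap z.x mx - r) (gap z.y my - r)) then scan mx my r L A
    else scan mx my r L ⟨A.s, A.sx, A.sy, A.p, A.q,
      A.ub + z.w * (z.n - qf (gap z.x mx - r) (gap z.y my - r)), z :: A.L⟩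

/-- The total is less than `l` on the box. -/
def Acc.small (l mx my r : ℕ) (A : Acc) : Bool :=
  (A.p + A.ub + 2 * (A.sx * mx + 3 * (A.sy * my)) + 2 * (gap A.sx (A.s * mx) * r)
    + 6 * (gap A.sy (A.s * my) * r) + 1).ble (l + A.q + A.s * qf mx my)

/-- All atoms are decided, and the quadratic total is at most `l`, with equality only at `t`. -/
def Acc.peak (l : ℕ) (A : Acc) (t : ℕ × ℕ) : Bool :=
  Nat.ble 1 A.s && A.sx.beq (A.s * t.1) && A.sy.beq (A.s * t.2)
    && (A.p + A.s * qf t.1 t.2).ble (l + A.q) && A.L.isEmpty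

/-- Verify that the total is at most `l` on the box, with equality only at points of `T`. -/
def check (l : ℕ) (T : List (ℕ × ℕ)) : ℕ → ℕ → ℕ → ℕ → Acc → Bool
  | 0, _, _, _, _ => false
  | k + 1, mx, my, r, A =>
    let A := scan mx my r A.L ⟨A.s, A.sx, A.sy, A.p, A.q, 0, []⟩
    let h := r / 2
    A.small l mx my r || T.any (A.peak l) || ((h + h).beq r
      && check l T k (mx - h) (my - h) h A && check l T k (mx - h) (my + h) h A
      && check l T k (mx + h) (my - h) h A && check l T k (mx + h) (my + h) h A)

/-- The value of a point mass at `c`. -/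
noncomputable def Atom.val (z : Atom) (c : ℝ × ℝ) : ℝ := z.w * max (z.n - hd (z.x, z.y) c) 0

/-- The total value of a list of point masses at `c`. -/
noncomputable def total (L : List Atom) (c : ℝ × ℝ) : ℝ := (L.map fun z => z.val c).sum

/-- The total value recorded in a state of the search. -/
noncomputable def Acc.val (A : Acc) (c : ℝ × ℝ) : ℝ :=
  A.p - A.q + 2 * (A.sx * c.1 + 3 * (A.sy * c.2)) - A.s * (c.1 ^ 2 + 3 * c.2 ^ 2) + total A.L c

/-- The box of radius `r` around `(mx, my)`. -/
def Box (mx my r : ℕ) : Set (ℝ × ℝ) := {c | |c.1 - mx| ≤ r ∧ |c.2 - my| ≤ r}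

lemma cast_gap (a b : ℕ) : (gap a b : ℝ) = |(a : ℝ) - b| := by
  unfold gap
  rcases le_total a b with h | h
  · rw [Nat.sub_eq_zero_of_le h, zero_add, Nat.cast_sub h, abs_sub_comm,
      abs_of_nonneg (sub_nonneg.2 (Nat.cast_le.2 h))]
  · rw [Nat.sub_eq_zero_of_le h, add_zero, Nat.cast_sub h,
      abs_of_nonneg (sub_nonneg.2 (Nat.cast_le.2 h))]

lemma abs_le_gap_add {a m r : ℕ} {c : ℝ} (hc : |c - m| ≤ r) :
    |(a : ℝ) - c| ≤ (gap a m + r : ℕ) := by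
  push_cast
  rw [cast_gap]
  linarith [abs_sub_le (a : ℝ) m c, abs_sub_comm c m]

lemma gap_sub_le_abs {a m r : ℕ} {c : ℝ} (hc : |c - m| ≤ r) :
    ((gap a m - r : ℕ) : ℝ) ≤ |(a : ℝ) - c| := by
  rcases le_total (gap a m) r with h | h
  · rw [Nat.sub_eq_zero_of_le h]; simp
  · rw [Nat.cast_sub h, cast_gap]
    linarith [abs_sub_le (a : ℝ) c m]

lemma hd_le_qf {z : Atom} {mx my r : ℕ} {c : ℝ × ℝ} (hc : c ∈ Box mx my r) :
    hd (z.x, z.y) c ≤ (qf (gap z.x mx + r) (gap z.y my + r) : ℕ) := by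
  have h1 := pow_le_pow_left₀ (abs_nonneg _) (abs_le_gap_add (a := z.x) hc.1) 2
  have h2 := pow_le_pow_left₀ (abs_nonneg _) (abs_le_gap_add (a := z.y) hc.2) 2
  rw [sq_abs] at h1 h2
  unfold hd qf
  push_cast at h1 h2 ⊢
  nlinarith

lemma qf_le_hd {z : Atom} {mx my r : ℕ} {c : ℝ × ℝ} (hc : c ∈ Box mx my r) :
    (qf (gap z.x mx - r) (gap z.y my - r) : ℕ) ≤ hd (z.x, z.y) c := by
  have h1 := pow_le_pow_left₀ (Nat.cast_nonneg _) (gap_sub_le_abs (a := z.x) hc.1) 2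
  have h2 := pow_le_pow_left₀ (Nat.cast_nonneg _) (gap_sub_le_abs (a := z.y) hc.2) 2
  rw [sq_abs] at h1 h2
  unfold hd qf
  push_cast
  nlinarith

lemma total_cons (z : Atom) (L : List Atom) (c : ℝ × ℝ) :
    total (z :: L) c = z.val c + total L c := by
  simp [total]

lemma scan_val {mx my r : ℕ} {c : ℝ × ℝ} (hc : c ∈ Box mx my r) (L : List Atom) (A : Acc) :
    (scan mx my r L A).val c = A.val c + total L c := by
  induction L generalizing A with
  | nil => simp [scan, total]
  | cons z L ih =>
    rw [scan, total_cons]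
    by_cases h1 : (qf (gap z.x mx + r) (gap z.y my + r)).ble z.n = true
    · have h := (hd_le_qf hc).trans (Nat.cast_le.2 (Nat.le_of_ble_eq_true h1))
      rw [h1, cond_true, ih, Atom.val, max_eq_left (sub_nonneg.2 h)]
      simp only [Acc.val, hd, qf]
      push_cast
      ring
    · rw [Bool.eq_false_of_not_eq_true h1, cond_false]
      by_cases h2 : z.n.ble (qf (gap z.x mx - r) (gap z.y my - r)) = true
      · have h := (Nat.cast_le.2 (Nat.le_of_ble_eq_true h2)).trans (qf_le_hd hc)
        rw [h2, cond_true, ih, Atom.val, max_eq_right (sub_nonpos.2 h), mul_zero, zero_add]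
      · rw [Bool.eq_false_of_not_eq_true h2, cond_false, ih]
        simp only [Acc.val, total_cons]
        ring

lemma scan_ub {mx my r : ℕ} {c : ℝ × ℝ} (hc : c ∈ Box mx my r) (L : List Atom) (A : Acc)
    (hA : total A.L c ≤ A.ub) :
    total (scan mx my r L A).L c ≤ (scan mx my r L A).ub := by
  induction L generalizing A with
  | nil => exact hA
  | cons z L ih =>
    rw [scan]
    by_cases h1 : (qf (gap z.x mx + r) (gap z.y my + r)).ble z.n = true
    · rw [h1, cond_true]
      exact ih _ hA
    · rw [Bool.eq_false_of_not_eq_true h1, cond_false]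
      by_cases h2 : z.n.ble (qf (gap z.x mx - r) (gap z.y my - r)) = true
      · rw [h2, cond_true]
        exact ih _ hA
      · rw [Bool.eq_false_of_not_eq_true h2, cond_false]
        refine ih _ ?_
        have h3 := qf_le_hd (z := z) hc
        have h4 : qf (gap z.x mx - r) (gap z.y my - r) ≤ z.n := by
          by_contra! h
          exact h2 (Nat.ble_eq_true_of_le h.le)
        have h5 : max ((z.n : ℝ) - hd (z.x, z.y) c) 0
            ≤ ((z.n - qf (gap z.x mx - r) (gap z.y my - r) : ℕ) : ℝ) := by
          refine max_le ?_ (Nat.cast_nonneg _)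
          rw [Nat.cast_sub h4]
          linarith
        rw [total_cons, Atom.val]
        push_cast
        linarith [mul_le_mul_of_nonneg_left h5 (Nat.cast_nonneg (α := ℝ) z.w)]

lemma Acc.val_lt {l mx my r : ℕ} {A : Acc} {c : ℝ × ℝ} (hc : c ∈ Box mx my r)
    (hA : total A.L c ≤ A.ub) (h : A.small l mx my r = true) : A.val c < l := by
  have h := Nat.cast_le (α := ℝ).2 (Nat.le_of_ble_eq_true h)
  unfold qf at h
  push_cast at h
  rw [cast_gap, cast_gap] at h
  push_cast at h
  obtain ⟨h1, h2⟩ := hc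
  have k1 : (c.1 - mx) * (A.sx - A.s * mx) ≤ |(A.sx : ℝ) - A.s * mx| * r := by
    refine (le_abs_self _).trans ?_
    rw [abs_mul, mul_comm]
    gcongr
  have k2 : (c.2 - my) * (A.sy - A.s * my) ≤ |(A.sy : ℝ) - A.s * my| * r := by
    refine (le_abs_self _).trans ?_
    rw [abs_mul, mul_comm]
    gcongr
  have k3 : 0 ≤ (A.s : ℝ) * ((c.1 - mx) ^ 2 + 3 * (c.2 - my) ^ 2) := by positivity
  unfold Acc.val
  linarith

lemma Acc.val_le {l : ℕ} {A : Acc} {c : ℝ × ℝ} {t : ℕ × ℕ} (h : A.peak l t = true) :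
    A.val c ≤ l ∧ (A.val c = l → c = (↑t.1, ↑t.2)) := by
  simp only [Acc.peak, Bool.and_eq_true, Nat.ble_eq, List.isEmpty_iff] at h
  obtain ⟨⟨⟨⟨h1, h2⟩, h3⟩, h4⟩, h5⟩ := h
  have h4 := Nat.cast_le (α := ℝ).2 h4
  have h1 : (1 : ℝ) ≤ A.s := by exact_mod_cast h1
  have h2 := Nat.eq_of_beq_eq_true h2
  have h3 := Nat.eq_of_beq_eq_true h3
  unfold qf at h4
  push_cast at h4
  have e : A.val c = A.p - A.q + A.s * (t.1 * t.1 + 3 * (t.2 * t.2))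
      - A.s * ((c.1 - t.1) ^ 2 + 3 * (c.2 - t.2) ^ 2) := by
    unfold Acc.val
    rw [h2, h3, h5]
    simp only [total, List.map_nil, List.sum_nil]
    push_cast
    ring
  have k : 0 ≤ (A.s : ℝ) * ((c.1 - t.1) ^ 2 + 3 * (c.2 - t.2) ^ 2) := by positivity
  refine ⟨by linarith, fun he => ?_⟩
  have k0 : (A.s : ℝ) * ((c.1 - t.1) ^ 2 + 3 * (c.2 - t.2) ^ 2) ≤ 0 := by linarith
  have k1 : (c.1 - t.1) ^ 2 + 3 * (c.2 - t.2) ^ 2 ≤ 0 :=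
    nonpos_of_mul_nonpos_right k0 (by linarith)
  have k2 := sq_nonneg (c.1 - t.1)
  have k3 := sq_nonneg (c.2 - t.2)
  ext
  · exact sub_eq_zero.1 (pow_eq_zero_iff two_ne_zero |>.1 (by linarith))
  · exact sub_eq_zero.1 (pow_eq_zero_iff two_ne_zero |>.1 (by linarith))

lemma Box.cover {m h r : ℕ} (hm : r ≤ m) (hr : h + h = r) {c : ℝ} (hc : |c - m| ≤ r) :
    |c - (m - h : ℕ)| ≤ h ∨ |c - (m + h : ℕ)| ≤ h := by
  rw [Nat.cast_sub (by omega)]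
  subst hr
  push_cast at hc ⊢
  rw [abs_le] at hc
  rcases le_total c m with h | h
  · left; rw [abs_le]; constructor <;> linarith
  · right; rw [abs_le]; constructor <;> linarith

lemma check_sound {l : ℕ} {T : List (ℕ × ℕ)} {k mx my r : ℕ} {A : Acc} {c : ℝ × ℝ}
    (h : check l T k mx my r A = true) (hx : r ≤ mx) (hy : r ≤ my) (hc : c ∈ Box mx my r) :
    A.val c ≤ l ∧ (A.val c = l → ∃ t ∈ T, c = (↑t.1, ↑t.2)) := by
  induction k generalizing mx my r A with
  | zero => exact absurd h (by simp [check])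
  | succ k ih =>
    rw [check] at h
    set B := scan mx my r A.L ⟨A.s, A.sx, A.sy, A.p, A.q, 0, []⟩ with hB
    have e : B.val c = A.val c := by
      rw [hB, scan_val hc]
      simp [Acc.val, total]
    have u : total B.L c ≤ B.ub := scan_ub hc _ _ (by simp [total])
    rw [← e]
    simp only [Bool.or_eq_true, Bool.and_eq_true, List.any_eq_true] at h
    rcases h with (h | ⟨t, ht, h⟩) | ⟨⟨⟨⟨hr, h1⟩, h2⟩, h3⟩, h4⟩
    · have := B.val_lt hc u h
      exact ⟨this.le, fun e => absurd e this.ne⟩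
    · exact ⟨(Acc.val_le h).1, fun e => ⟨t, ht, (Acc.val_le h).2 e⟩⟩
    · have hr := Nat.eq_of_beq_eq_true hr
      rcases Box.cover hx hr hc.1 with hcx | hcx <;>
        rcases Box.cover hy hr hc.2 with hcy | hcy
      · exact ih h1 (by omega) (by omega) ⟨hcx, hcy⟩
      · exact ih h2 (by omega) (by omega) ⟨hcx, hcy⟩
      · exact ih h3 (by omega) (by omega) ⟨hcx, hcy⟩
      · exact ih h4 (by omega) (by omega) ⟨hcx, hcy⟩

/-- The price function of a tree, with the prices scaled by `m`. -/
noncomputable def PTree.price : PTree → ℝ → ℝ × ℝ → ℝ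
  | leaf a b c, m => fun x =>
    m * ((1 - x.1 - x.2) * a + (x.1 - x.2) * b + 2 * x.2 * c) - (x.1 + x.2) + hd x (0, 0)
  | node t₁ t₂ t₃, m => comb (t₁.price (16 * m)) (t₂.price (16 * m)) (t₃.price (4 * m))

/-- The mean of the price function of a tree. -/
def PTree.mean : PTree → ℚ → ℚ
  | leaf a b c, m => m * (a + b + 2 * c) / 4 - 7/44
  | node t₁ t₂ t₃, m => (t₁.mean (16 * m) + t₂.mean (16 * m)) / 80 + 3/20 * t₃.mean (4 * m)

/-- At the vertices of the cylinders, the price is at most the square of the given affine map. -/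
def PTree.dominated : PTree → ℚ → ℚ → ℚ → ℚ → Bool
  | leaf a b c, m, α, β, γ => decide (m * a ≤ α ^ 2) && decide (m * b ≤ (α + β) ^ 2)
    && decide (m * c ≤ (α + β / 2 + γ / 2) ^ 2)
  | node t₁ t₂ t₃, m, α, β, γ => t₁.dominated (16 * m) (4 * α) β γ
    && t₂.dominated (16 * m) (4 * α + 3 * β) β γ
    && t₃.dominated (4 * m) (2 * α + β / 2 + γ / 2) β γ

/-- The side length `s` and the mass `w` can be divided as required by the tree. -/
def PTree.fits : PTree → ℕ → ℕ → Bool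
  | leaf _ _ _, s, _ => decide (2 * (s / 2) = s)
  | node t₁ t₂ t₃, s, w => decide (4 * (s / 4) = s) && decide (5 * (w / 5) = w)
    && t₁.fits (s / 4) (w / 5) && t₂.fits (s / 4) (w / 5) && t₃.fits (s / 2) (3 * (w / 5))

section
variable {Q : Measure (ℝ × ℝ)} [IsProbabilityMeasure Q]

lemma PTree.integrable_price (hQ : SelfSim Q) (t : PTree) (m : ℝ) : Integrable (t.price m) Q := by
  induction t generalizing m with
  | leaf a b c => exact hQ.integrable_of_continuous (by unfold price hd; fun_prop)
  | node t₁ t₂ t₃ h1 h2 h3 => exact hQ.integrable_comb (h1 _) (h2 _) (h3 _)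

lemma PTree.integral_price (hQ : SelfSim Q) (t : PTree) (m : ℚ) :
    ∫ x, t.price m x ∂Q = t.mean m := by
  induction t generalizing m with
  | leaf a b c =>
    have e : ∀ x : ℝ × ℝ, price (leaf a b c) m x
        = (m * a + (m * (b - a) - 1) * x.1 + (m * (2 * c - a - b) - 1) * x.2) + hd x (0, 0) := by
      intro x; simp only [price]; ring
    rw [integral_congr_ae (ae_of_all _ e), integral_add
      (hQ.integrable_of_continuous (by fun_prop)) (hQ.integrable_hd _), hQ.integral_affine,
      hQ.integral_hd]
    simp only [mean, hd]
    push_cast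
    ring
  | node t₁ t₂ t₃ h1 h2 h3 =>
    rw [price, hQ.integral_comb (t₁.integrable_price hQ _) (t₂.integrable_price hQ _)
      (t₃.integrable_price hQ _)]
    have h1 := h1 (16 * m)
    have h2 := h2 (16 * m)
    have h3 := h3 (4 * m)
    push_cast at h1 h2 h3
    rw [h1, h2, h3, mean]
    push_cast
    ring

lemma PTree.price_le (hQ : SelfSim Q) (t : PTree) {m α β γ : ℚ} (h : t.dominated m α β γ = true)
    (h1 : β ^ 2 ≤ 1) (h2 : (β + γ) ^ 2 ≤ 4) (h3 : (γ - β) ^ 2 ≤ 4) :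
    ∀ᵐ x ∂Q, t.price m x ≤ (α + β * x.1 + γ * x.2) ^ 2 := by
  induction t generalizing m α with
  | leaf a b c =>
    simp only [dominated, Bool.and_eq_true, decide_eq_true_eq] at h
    obtain ⟨⟨ha, hb⟩, hc⟩ := h
    have ha : (m * a : ℝ) ≤ α ^ 2 := by exact_mod_cast ha
    have hb : (m * b : ℝ) ≤ (α + β) ^ 2 := by exact_mod_cast hb
    have hc : (m * c : ℝ) ≤ (α + β / 2 + γ / 2) ^ 2 := by exact_mod_cast hc
    have h1 : (β : ℝ) ^ 2 ≤ 1 := by exact_mod_cast h1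
    have h2 : (β + γ : ℝ) ^ 2 ≤ 4 := by exact_mod_cast h2
    have h3 : (γ - β : ℝ) ^ 2 ≤ 4 := by exact_mod_cast h3
    filter_upwards [hQ.ae_mem] with x ⟨x1, x2, x3⟩
    have b0 : 0 ≤ 1 - x.1 - x.2 := by linarith
    have b1 : 0 ≤ x.1 - x.2 := by linarith
    have b2 : 0 ≤ 2 * x.2 := by linarith
    have k0 := mul_le_mul_of_nonneg_left ha b0
    have k1 := mul_le_mul_of_nonneg_left hb b1
    have k2 := mul_le_mul_of_nonneg_left hc b2
    have l1 := mul_le_mul_of_nonneg_left h1 (mul_nonneg b0 b1)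
    have l2 := mul_le_mul_of_nonneg_left h2 (mul_nonneg b0 b2)
    have l3 := mul_le_mul_of_nonneg_left h3 (mul_nonneg b1 b2)
    simp only [price, hd]
    linarith
  | node t₁ t₂ t₃ i1 i2 i3 =>
    simp only [dominated, Bool.and_eq_true] at h
    obtain ⟨⟨j1, j2⟩, j3⟩ := h
    refine hQ.ae_of_comp ?_ ?_ ?_
    · filter_upwards [i1 j1, hQ.ae_mem] with x hx hT
      rw [price, comb_T₁ hT]
      push_cast at hx
      simp only [T₁]
      linarith
    · filter_upwards [i2 j2, hQ.ae_mem] with x hx hT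
      rw [price, comb_T₂ hT]
      push_cast at hx
      simp only [T₂]
      linarith
    · filter_upwards [i3 j3, hQ.ae_mem] with x hx hT
      rw [price, comb_T₃ hT]
      push_cast at hx
      simp only [T₃]
      linarith

lemma SelfSim.excess_leaf_le (hQ : SelfSim Q) (a b d : ℕ) (m : ℝ) (c : ℝ × ℝ) :
    excess Q ((PTree.leaf a b d).price m) c ≤ max (m * a - hd (0, 0) c) 0 / 4
      + max (m * b - hd (1, 0) c) 0 / 4 + max (m * d - hd (1/2, 1/2) c) 0 / 2 := by
  set A := max (m * a - hd (0, 0) c) 0 with hA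
  set B := max (m * b - hd (1, 0) c) 0 with hB
  set D := max (m * d - hd (1/2, 1/2) c) 0 with hD
  have key : ∀ᵐ x ∂Q, max ((PTree.leaf a b d).price m x - hd x c) 0
      ≤ A + (B - A) * x.1 + (2 * D - A - B) * x.2 := by
    filter_upwards [hQ.ae_mem] with x ⟨x1, x2, x3⟩
    have b0 : 0 ≤ 1 - x.1 - x.2 := by linarith
    have b1 : 0 ≤ x.1 - x.2 := by linarith
    have b2 : 0 ≤ 2 * x.2 := by linarith
    have k0 := mul_le_mul_of_nonneg_left (le_max_left (m * a - hd (0, 0) c) 0) b0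
    have k1 := mul_le_mul_of_nonneg_left (le_max_left (m * b - hd (1, 0) c) 0) b1
    have k2 := mul_le_mul_of_nonneg_left (le_max_left (m * d - hd (1/2, 1/2) c) 0) b2
    have l0 := mul_nonneg b0 (le_max_right (m * a - hd (0, 0) c) 0)
    have l1 := mul_nonneg b1 (le_max_right (m * b - hd (1, 0) c) 0)
    have l2 := mul_nonneg b2 (le_max_right (m * d - hd (1/2, 1/2) c) 0)
    rw [← hA] at k0 l0
    rw [← hB] at k1 l1
    rw [← hD] at k2 l2
    refine max_le ?_ (by linarith)
    simp only [PTree.price, hd] at k0 k1 k2 ⊢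
    linarith
  refine (integral_mono_ae (hQ.integrable_excess (PTree.integrable_price hQ _ _) c)
    (hQ.integrable_of_continuous (by fun_prop)) key).trans_eq ?_
  rw [hQ.integral_affine]
  ring

lemma PTree.excess_le_total (hQ : SelfSim Q) (t : PTree) {x y s w : ℕ} {m : ℝ}
    (h : t.fits s w = true) (hs : 0 < s) (hm : m * s ^ 2 = 1) (L : List Atom) (c : ℝ × ℝ) :
    4 * w * s ^ 2 * excess Q (t.price m) c + total L (x + s * c.1, y + s * c.2)
      ≤ total (t.atoms x y s w L) (x + s * c.1, y + s * c.2) := by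
  induction t generalizing x y s w m L c with
  | leaf a b d =>
    simp only [fits, decide_eq_true_eq] at h
    rw [atoms]
    generalize s / 2 = k at h ⊢
    subst h
    push_cast at hm
    have e : ∀ (n : ℕ) (u : ℝ × ℝ), max (n - hd (x + 2 * k * u.1, y + 2 * k * u.2)
        (x + (2 * k : ℕ) * c.1, y + (2 * k : ℕ) * c.2)) 0
        = (2 * k) ^ 2 * max (m * n - hd u c) 0 := by
      intro n u
      rw [mul_max_of_nonneg _ _ (by positivity), mul_zero]
      congr 1
      simp only [hd]
      push_cast
      linear_combination - (n : ℝ) * hm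
    have ea := e a (0, 0)
    have eb := e b (1, 0)
    have ed := e d (1/2, 1/2)
    simp only [mul_zero, add_zero, mul_one] at ea eb
    have hk : (2 * k * (1 / 2) : ℝ) = k := by ring
    simp only [hk] at ed
    simp only [total_cons, Atom.val]
    push_cast at ea eb ed ⊢
    rw [ea, eb, ed]
    have := mul_le_mul_of_nonneg_left (hQ.excess_leaf_le a b d m c)
      (show (0 : ℝ) ≤ 4 * w * (2 * k) ^ 2 by positivity)
    linarith
  | node t₁ t₂ t₃ h1 h2 h3 =>
    simp only [fits, Bool.and_eq_true, decide_eq_true_eq] at h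
    obtain ⟨⟨⟨⟨hs4, hw5⟩, f1⟩, f2⟩, f3⟩ := h
    have hs2 : s / 2 = 2 * (s / 4) := by omega
    rw [price, atoms, hQ.excess_comb (integrable_price hQ _ _) (integrable_price hQ _ _)
      (integrable_price hQ _ _)]
    rw [hs2] at f3 ⊢
    generalize s / 4 = k at *
    generalize w / 5 = v at *
    subst hs4
    subst hw5
    have hk : 0 < k := by omega
    push_cast at hm
    set L₃ := t₃.atoms (x + k) (y + k) (2 * k) (3 * v) L
    set L₂ := t₂.atoms (x + 3 * k) y k v L₃
    have i1 := h1 (x := x) (y := y) (m := 16 * m) f1 hk (by linarith) L₂ (R₁ c)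
    have i2 := h2 (x := x + 3 * k) (y := y) (m := 16 * m) f2 hk (by linarith) L₃ (R₂ c)
    have i3 := h3 (x := x + k) (y := y + k) (m := 4 * m) f3 (by omega)
      (by push_cast; linarith) L (R₃ c)
    have e1 : ((x : ℝ) + k * (R₁ c).1, (y : ℝ) + k * (R₁ c).2)
        = ((x : ℝ) + (4 * k : ℕ) * c.1, (y : ℝ) + (4 * k : ℕ) * c.2) := by
      simp only [R₁]; push_cast; congr 1 <;> ring
    have e2 : (((x + 3 * k : ℕ) : ℝ) + k * (R₂ c).1, (y : ℝ) + k * (R₂ c).2)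
        = ((x : ℝ) + (4 * k : ℕ) * c.1, (y : ℝ) + (4 * k : ℕ) * c.2) := by
      simp only [R₂]; push_cast; congr 1 <;> ring
    have e3 : (((x + k : ℕ) : ℝ) + (2 * k : ℕ) * (R₃ c).1,
        ((y + k : ℕ) : ℝ) + (2 * k : ℕ) * (R₃ c).2)
        = ((x : ℝ) + (4 * k : ℕ) * c.1, (y : ℝ) + (4 * k : ℕ) * c.2) := by
      simp only [R₃]; push_cast; congr 1 <;> ring
    rw [e1] at i1
    rw [e2] at i2
    rw [e3] at i3
    push_cast at i1 i2 i3 ⊢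
    linarith

end

/-- Verify the bounds in `Reach`. -/
def PTree.reach (t : PTree) (m r : ℚ) : Bool :=
  t.dominated m r (1/2) (3/2) && t.dominated m (r + 1/2) (-1/2) (3/2)
    && t.dominated m (387/256) (-1/2) (-3/2) && t.dominated m (387/256 - 1/2) (1/2) (-3/2)
    && t.dominated m 1 1 0 && t.dominated m 2 (-1) 0

/-- The scale of the tree prices: a price `n` stands for `n * scale`. -/
def scale : ℚ := 1/3774873600

/-- Verify that a tree is a certificate, with total at most `l`, attained at most on `T`. -/
def PTree.valid (t : PTree) (r : ℚ) (l : ℕ) (T : List (ℕ × ℕ)) : Bool :=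
  t.reach scale r && t.fits 61440 3125
    && check l T 30 153600 153600 122880 ⟨0, 0, 0, 0, 0, 0, t.atoms 122880 122880 61440 3125 []⟩

section
variable {Q : Measure (ℝ × ℝ)} [IsProbabilityMeasure Q]

lemma PTree.ae_reach (hQ : SelfSim Q) {t : PTree} {m r : ℚ} (h : t.reach m r = true) :
    ∀ᵐ x ∂Q, Reach r x (t.price m x) := by
  simp only [reach, Bool.and_eq_true] at h
  obtain ⟨⟨⟨⟨⟨h1, h2⟩, h3⟩, h4⟩, h5⟩, h6⟩ := h
  filter_upwards [t.price_le hQ h1 (by norm_num) (by norm_num) (by norm_num),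
    t.price_le hQ h2 (by norm_num) (by norm_num) (by norm_num),
    t.price_le hQ h3 (by norm_num) (by norm_num) (by norm_num),
    t.price_le hQ h4 (by norm_num) (by norm_num) (by norm_num),
    t.price_le hQ h5 (by norm_num) (by norm_num) (by norm_num),
    t.price_le hQ h6 (by norm_num) (by norm_num) (by norm_num)] with x h1 h2 h3 h4 h5 h6
  push_cast at h1 h2 h3 h4 h5 h6
  exact ⟨h1.trans_eq (by unfold left; ring), h2.trans_eq (by unfold right; ring),
    h3.trans_eq (by unfold left; ring), h4.trans_eq (by unfold right; ring),
    h5.trans_eq (by ring), h6.trans_eq (by ring)⟩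

lemma Zone.mem_box {r : ℝ} {c : ℝ × ℝ} (hr : r ≤ 1) (h : Zone r c) :
    (122880 + 61440 * c.1, 122880 + 61440 * c.2) ∈ Box 153600 153600 122880 := by
  obtain ⟨h1, h2, h3, h4, h5, h6⟩ := h
  unfold left at h1 h3
  unfold right at h2 h4
  constructor <;> rw [abs_le] <;> push_cast <;> constructor <;> linarith

lemma PTree.cert (hQ : SelfSim Q) {t : PTree} {r : ℚ} {l : ℕ} {T : List (ℕ × ℕ)}
    (h : t.valid r l T = true) (hl : 0 < l) (hr : 0 ≤ r) (hr1 : r ≤ 1)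
    (hT : ∀ p ∈ T, Canon (((p.1 : ℝ) - 122880) / 61440, ((p.2 : ℝ) - 122880) / 61440)) :
    Cert Q r (l / 47185920000000) (t.price scale) := by
  simp only [valid, Bool.and_eq_true] at h
  obtain ⟨⟨h1, h2⟩, h3⟩ := h
  have hl' : (0 : ℝ) < l := Nat.cast_pos.2 hl
  have hreach := PTree.ae_reach hQ h1
  have key : ∀ c, excess Q (t.price scale) c ≤ l / 47185920000000 ∧
      (excess Q (t.price scale) c = l / 47185920000000 → Canon c) := by
    intro c
    by_cases h0 : excess Q (t.price scale) c = 0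
    · rw [h0]
      exact ⟨by positivity, fun e => absurd e (by positivity)⟩
    have hz : Zone r c := by
      by_contra hz
      refine h0 ((integral_congr_ae ?_).trans (integral_zero _ _))
      filter_upwards [hQ.ae_mem, hreach] with x hx h
      exact max_eq_right (sub_nonpos.2 (le_of_not_gt fun hlt =>
        hz (h.zone (by exact_mod_cast hr) hx hlt)))
    have hbox := hz.mem_box (by exact_mod_cast hr1)
    have hle := t.excess_le_total hQ (x := 122880) (y := 122880) (m := scale) h2 (by norm_num)
      (by norm_num [scale]) [] c
    obtain ⟨k1, k2⟩ := check_sound h3 (by norm_num) (by norm_num) hbox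
    simp only [Acc.val, Nat.cast_zero, zero_mul, mul_zero, add_zero, sub_zero, zero_add]
      at k1 k2
    simp only [total, List.map_nil, List.sum_nil, Nat.cast_ofNat, add_zero] at hle k1 k2
    refine ⟨(le_div_iff₀ (by norm_num)).2 (by linarith), fun e => ?_⟩
    rw [eq_div_iff (by norm_num)] at e
    obtain ⟨p, hp, hc⟩ := k2 (le_antisymm k1 (by linarith))
    convert hT p hp using 1
    rw [Prod.mk.injEq] at hc
    ext
    · simp only [← hc.1]; ring
    · simp only [← hc.2]; ring
  exact ⟨PTree.integrable_price hQ _ _, fun c => (key c).1, fun c => (key c).2, hreach⟩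

end

/-- Optimal prices for one point. -/
def treeOne : PTree :=
  .node
    (.leaf 3597327856 1532462729 920277654)
    (.leaf 1532462729 3597327856 920277654)
    (.node
      (.leaf 581991144 325016617 525934264)
      (.leaf 325016617 581991144 525934264)
      (.leaf 529803510 529803510 987242542))

/-- Optimal prices for one or two points. -/
def treeTwo : PTree :=
  .node
    (.leaf 2223304291 1182386671 833397719)
    (.leaf 1182386671 2223304291 833397719)
    (.node
      (.leaf 500265125 316734603 515573465)
      (.leaf 316734603 500265125 515573465)
      (.leaf 529803510 529803510 898870804))

/-- Optimal prices for two or three points. -/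
def treeThree : PTree :=
  .node
    (.leaf 2252160164 660791624 814346506)
    (.leaf 660791623 2252160165 814346506)
    (.node
      (.node
        (.leaf 422810336 391809005 359450584)
        (.leaf 326265424 378429285 399552676)
        (.leaf 359721861 311980196 466613699))
      (.node
        (.leaf 378429285 326265424 399552676)
        (.leaf 391809005 422810336 359450584)
        (.leaf 311980196 359721861 466613699))
      (.leaf 564595262 564595262 651420089))

/-- Optimal prices for three or four points. -/
def treeFour : PTree :=
  .node
    (.leaf 224372598 513433544 176684129)
    (.leaf 513433544 224372598 176684129)
    (.node
      (.node
        (.leaf 438220195 434338763 396049054)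
        (.leaf 317095281 338731991 308804245)
        (.leaf 291004794 276066468 257745431))
      (.node
        (.leaf 338731991 317095281 308804245)
        (.leaf 434338763 438220195 396049054)
        (.leaf 276066468 291004794 257745431))
      (.node
        (.leaf 141855835 74109057 119021458)
        (.leaf 74109057 141855835 119021458)
        (.leaf 138637753 138637753 221207111)))

/-- Optimal prices for four or five points. -/
def treeFive : PTree :=
  .node
    (.leaf 208075176 513433544 105206600)
    (.leaf 513433544 208075176 105206600)
    (.node
      (.leaf 372878617 275141807 243695388)
      (.leaf 275141807 372878617 243695388)
      (.node
        (.node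
          (.leaf 105682452 97899663 89855303)
          (.leaf 82150334 87506289 93883761)
          (.leaf 85294449 100106515 105069937))
        (.node
          (.leaf 87506289 82150334 93883761)
          (.leaf 97899663 105682452 89855303)
          (.leaf 100106515 85294449 105069937))
        (.leaf 141274644 141274644 165108384)))

section
variable {Q : Measure (ℝ × ℝ)} [IsProbabilityMeasure Q]

lemma canon_left : Canon (1/8, 1/16) := by
  convert Canon.center.T₁ using 1; norm_num [T₁]

lemma canon_right : Canon (7/8, 1/16) := by
  convert Canon.center.T₂ using 1; norm_num [T₂]

lemma canon_top : Canon (1/2, 3/8) := by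
  convert Canon.center.T₃ using 1; norm_num [T₃]

lemma canon_top_left : Canon (5/16, 9/32) := by
  convert canon_left.T₃ using 1; norm_num [T₃]

lemma canon_top_right : Canon (11/16, 9/32) := by
  convert canon_right.T₃ using 1; norm_num [T₃]

lemma canon_top_base : Canon (1/2, 9/32) := by
  convert Canon.base.T₃ using 1; norm_num [T₃]

lemma canon_top_top : Canon (1/2, 7/16) := by
  convert canon_top.T₃ using 1; norm_num [T₃]

lemma PTree.tight (hQ : SelfSim Q) {t : PTree} {r s F : ℚ} {l n : ℕ} {T : List (ℕ × ℕ)}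
    (h : t.valid r l T = true) (hl : 0 < l) (hr : 0 ≤ r) (hr1 : r ≤ 1)
    (hT : ∀ p ∈ T, Canon (((p.1 : ℝ) - 122880) / 61440, ((p.2 : ℝ) - 122880) / 61440))
    (hs : s = l / 47185920000000) (hF : t.mean scale = F) (hn : qe Q n ≤ F - s * n) :
    Tight Q r s n := by
  refine ⟨t.price scale, ?_, ?_⟩
  · rw [hs]
    push_cast
    exact PTree.cert hQ h hl hr hr1 hT
  · rw [PTree.integral_price hQ, hF]
    linarith

lemma SelfSim.qe_one_le (hQ : SelfSim Q) : qe Q 1 ≤ 27/176 := by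
  refine (qe_le (α := {(1/2, 1/4)}) (by simp) (by simp)).trans_eq ?_
  simp only [distor, image_singleton, csInf_singleton, hQ.integral_hd_center]

lemma SelfSim.qe_two_le (hQ : SelfSim Q) : qe Q 2 ≤ 27/176 - 9/128 := by
  have hα : ({(1/2, 1/16), (1/2, 3/8)} : Set (ℝ × ℝ)).Finite := toFinite _
  have hi := hQ.integrable_sInf_hd hα (insert_nonempty _ _)
  obtain ⟨i1, i2, i3⟩ := hQ.integrable_iff.1 hi
  refine (qe_le (α := {(1/2, 1/16), (1/2, 3/8)}) ?_ ?_).trans ?_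
  · exact one_le_encard_iff_nonempty.2 (insert_nonempty _ _)
  · rw [encard_pair (by norm_num)]
    rfl
  have j1 := integral_mono i1 ((hQ.integrable_hd _).div_const 16)
    fun x => (sInf_hd_le (T₁ x) (mem_insert (1/2, 1/16) {(1/2, 3/8)})).trans_eq (hd_T₁ x _)
  have j2 := integral_mono i2 ((hQ.integrable_hd _).div_const 16)
    fun x => (sInf_hd_le (T₂ x) (mem_insert (1/2, 1/16) {(1/2, 3/8)})).trans_eq (hd_T₂ x _)
  have j3 := integral_mono i3 ((hQ.integrable_hd _).div_const 4)
    fun x => (sInf_hd_le (T₃ x) (mem_insert_of_mem (1/2, 1/16) (mem_singleton (1/2, 3/8)))).trans_eq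
      (hd_T₃ x _)
  rw [integral_div, hQ.integral_hd] at j1 j2 j3
  rw [distor, hQ.integral_eq hi]
  refine (add_le_add (add_le_add (mul_le_mul_of_nonneg_left j1 (by norm_num))
    (mul_le_mul_of_nonneg_left j2 (by norm_num)))
    (mul_le_mul_of_nonneg_left j3 (by norm_num))).trans_eq ?_
  norm_num [hd, R₁, R₂, R₃]

lemma SelfSim.qe_three_le (hQ : SelfSim Q) : qe Q 3 ≤ 27/176 - 9/128 - 9/160 := by
  linarith [hQ.qe_add_le (a := 1) (b := 1) (c := 1) le_rfl le_rfl le_rfl, hQ.qe_one_le]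

lemma SelfSim.qe_four_le (hQ : SelfSim Q) :
    qe Q 4 ≤ 27/176 - 9/128 - 9/160 - 27/2560 := by
  linarith [hQ.qe_add_le (a := 1) (b := 1) (c := 2) le_rfl le_rfl (by norm_num), hQ.qe_one_le,
    hQ.qe_two_le]

lemma SelfSim.qe_five_le (hQ : SelfSim Q) :
    qe Q 5 ≤ 27/176 - 9/128 - 9/160 - 27/2560 - 27/3200 := by
  linarith [hQ.qe_add_le (a := 1) (b := 1) (c := 3) le_rfl le_rfl (by norm_num), hQ.qe_one_le,
    hQ.qe_three_le]

lemma SelfSim.tight_treeOne (hQ : SelfSim Q) :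
    Tight Q (125/128) (81/640) 1 := by
  have h : treeOne.valid (125/128) 5971968000000
      [(153600, 138240)] = true := by
    decide +kernel
  have hm : treeOne.mean scale = 27/176 + 81/640 := by decide +kernel
  have key (n : ℕ) (hn : qe Q n ≤
      ((27/176 + 81/640 : ℚ) : ℝ) - ((81/640 : ℚ) : ℝ) * n) :=
    PTree.tight hQ h (by norm_num) (by norm_num) (by norm_num)
      (by
          simp only [List.forall_mem_cons]
          norm_num [Canon.center])
      (by norm_num) hm hn
  push_cast at key
  exact key 1 (by have := hQ.qe_one_le; push_cast; linarith)

lemma SelfSim.tight_treeTwo (hQ : SelfSim Q) :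
    Tight Q (125/128) (9/128) 1 ∧ Tight Q (125/128) (9/128) 2 := by
  have h : treeTwo.valid (125/128) 3317760000000
      [(153600, 138240), (153600, 126720), (153600, 145920)] = true := by
    decide +kernel
  have hm : treeTwo.mean scale = 27/176 + 9/128 := by decide +kernel
  have key (n : ℕ) (hn : qe Q n ≤
      ((27/176 + 9/128 : ℚ) : ℝ) - ((9/128 : ℚ) : ℝ) * n) :=
    PTree.tight hQ h (by norm_num) (by norm_num) (by norm_num)
      (by
          simp only [List.forall_mem_cons]
          norm_num [Canon.center, Canon.base, canon_top])
      (by norm_num) hm hn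
  push_cast at key
  exact ⟨key 1 (by have := hQ.qe_one_le; push_cast; linarith),
    key 2 (by have := hQ.qe_two_le; push_cast; linarith)⟩

lemma SelfSim.tight_treeThree (hQ : SelfSim Q) :
    Tight Q (125/128) (9/160) 2 ∧ Tight Q (125/128) (9/160) 3 := by
  have h : treeThree.valid (125/128) 2654208000000
      [(153600, 126720), (153600, 145920), (130560, 126720), (176640, 126720)] = true := by
    decide +kernel
  have hm : treeThree.mean scale = 27/176 - 9/128 + 2 * (9/160) := by decide +kernel
  have key (n : ℕ) (hn : qe Q n ≤
      ((27/176 - 9/128 + 2 * (9/160) : ℚ) : ℝ) - ((9/160 : ℚ) : ℝ) * n) :=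
    PTree.tight hQ h (by norm_num) (by norm_num) (by norm_num)
      (by
          simp only [List.forall_mem_cons]
          norm_num [Canon.base, canon_top, canon_left, canon_right])
      (by norm_num) hm hn
  push_cast at key
  exact ⟨key 2 (by have := hQ.qe_two_le; push_cast; linarith),
    key 3 (by have := hQ.qe_three_le; push_cast; linarith)⟩

lemma SelfSim.tight_treeFour (hQ : SelfSim Q) :
    Tight Q (125/512) (27/2560) 3 ∧ Tight Q (125/512) (27/2560) 4 := by
  have h : treeFour.valid (125/512) 497664000000
      [(153600, 145920), (130560, 126720), (176640, 126720), (153600, 140160),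
        (153600, 149760)] = true := by
    decide +kernel
  have hm : treeFour.mean scale = 27/176 - 9/128 - 9/160 + 3 * (27/2560) := by decide +kernel
  have key (n : ℕ) (hn : qe Q n ≤
      ((27/176 - 9/128 - 9/160 + 3 * (27/2560) : ℚ) : ℝ) - ((27/2560 : ℚ) : ℝ) * n) :=
    PTree.tight hQ h (by norm_num) (by norm_num) (by norm_num)
      (by
          simp only [List.forall_mem_cons]
          norm_num [canon_top, canon_left, canon_right, canon_top_base, canon_top_top])
      (by norm_num) hm hn
  push_cast at key
  exact ⟨key 3 (by have := hQ.qe_three_le; push_cast; linarith),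
    key 4 (by have := hQ.qe_four_le; push_cast; linarith)⟩

lemma SelfSim.tight_treeFive (hQ : SelfSim Q) :
    Tight Q (125/512) (27/3200) 4 ∧ Tight Q (125/512) (27/3200) 5 := by
  have h : treeFive.valid (125/512) 398131200000
      [(130560, 126720), (176640, 126720), (142080, 140160), (165120, 140160), (153600, 140160),
        (153600, 149760)] = true := by
    decide +kernel
  have hm : treeFive.mean scale = 27/176 - 9/128 - 9/160 - 27/2560 + 4 * (27/3200) := by
    decide +kernel
  have key (n : ℕ) (hn : qe Q n ≤
      ((27/176 - 9/128 - 9/160 - 27/2560 + 4 * (27/3200) : ℚ) : ℝ) - ((27/3200 : ℚ) : ℝ) * n) :=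
    PTree.tight hQ h (by norm_num) (by norm_num) (by norm_num)
      (by
          simp only [List.forall_mem_cons]
          norm_num [canon_left, canon_right, canon_top_left, canon_top_right, canon_top_base,
            canon_top_top])
      (by norm_num) hm hn
  push_cast at key
  exact ⟨key 4 (by have := hQ.qe_four_le; push_cast; linarith),
    key 5 (by have := hQ.qe_five_le; push_cast; linarith)⟩

end

/-- There is a cost at which both `n` and `n + 1` points are optimal. -/
def Step (Q : Measure (ℝ × ℝ)) (r : ℝ) (n : ℕ) : Prop :=
  ∃ l : ℝ, 0 < l ∧ Tight Q r l n ∧ Tight Q r l (n + 1)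

/-- The numbers of points `a`, `b`, `c` in the three pieces of the triangle balance at cost `l`. -/
structure Balanced (Q : Measure (ℝ × ℝ)) (l : ℝ) (a b c : ℕ) : Prop where
  one_le_left : 1 ≤ a
  one_le_right : 1 ≤ b
  three_le : 3 ≤ c
  tight_left : Tight Q (125/128) (80 * l) a
  tight_right : Tight Q (125/128) (80 * l) b
  tight_top : Tight Q (125/512) (20 * l / 3) c

section
variable {Q : Measure (ℝ × ℝ)} [IsProbabilityMeasure Q]

lemma Step.mono {n : ℕ} (hQ : SelfSim Q) (h : Step Q (125/512) n) : Step Q (125/128) n := by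
  obtain ⟨l, hl, h1, h2⟩ := h
  exact ⟨l, hl, h1.mono hQ (by norm_num) (by norm_num), h2.mono hQ (by norm_num) (by norm_num)⟩

lemma Tight.cost_le {r s l m : ℝ} {n : ℕ} (hQ : SelfSim Q) (hn : 1 ≤ n) (hl : 0 ≤ l) (hm : 0 ≤ m)
    (h : Tight Q r l n) (h' : Tight Q s m (n + 1)) : m ≤ l := by
  have h1 := h.le hQ hl (n := n + 1) (by omega)
  have h2 := h'.le hQ hm hn
  push_cast at h1 h2
  linarith

lemma Balanced.tight {l : ℝ} {a b c : ℕ} (hQ : SelfSim Q) (h : Balanced Q l a b c) :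
    Tight Q (125/512) l (a + b + c) :=
  Tight.comb hQ h.one_le_left h.one_le_right (by have := h.three_le; omega) h.tight_left
    h.tight_right h.tight_top

lemma Balanced.exists_succ {l : ℝ} {a b c : ℕ} (hQ : SelfSim Q) (hl : 0 ≤ l)
    (h : Balanced Q l a b c) (ha : Step Q (125/128) a) (hb : Step Q (125/128) b)
    (hc : Step Q (125/512) c) :
    ∃ m : ℝ, 0 < m ∧ Balanced Q m a b c ∧
      ∃ a' b' c', a' + b' + c' = a + b + c + 1 ∧ Balanced Q m a' b' c' := by
  obtain ⟨h1, h2, h3, ta, tb, tc⟩ := h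
  obtain ⟨u, hu, ua, ua'⟩ := ha
  obtain ⟨v, hv, vb, vb'⟩ := hb
  obtain ⟨w, hw, wc, wc'⟩ := hc
  have hul := ta.cost_le hQ h1 (by positivity) hu.le ua'
  have hvl := tb.cost_le hQ h2 (by positivity) hv.le vb'
  have hwl := tc.cost_le hQ (by omega) (by positivity) hw.le wc'
  have key : ∀ m, m ≤ l → u ≤ 80 * m → v ≤ 80 * m → w ≤ 20 * m / 3 → Balanced Q m a b c :=
    fun m h0 hu hv hw => ⟨h1, h2, h3, ua.convex hQ ta hu (by linarith),
      vb.convex hQ tb hv (by linarith), wc.convex hQ tc hw (by linarith)⟩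
  by_cases h4 : v ≤ u ∧ 12 * w ≤ u
  · have k := key (u / 80) (by linarith) (by linarith) (by linarith) (by linarith)
    refine ⟨u / 80, by positivity, k, a + 1, b, c, by omega,
      { k with one_le_left := by omega, tight_left := ?_ }⟩
    rwa [mul_div_cancel₀ u (by norm_num)]
  by_cases h5 : 12 * w ≤ v
  · have h6 : u ≤ v := by
      by_contra! h6
      exact h4 ⟨h6.le, by linarith⟩
    have k := key (v / 80) (by linarith) (by linarith) (by linarith) (by linarith)
    refine ⟨v / 80, by positivity, k, a, b + 1, c, by omega,
      { k with one_le_right := by omega, tight_right := ?_ }⟩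
    rwa [mul_div_cancel₀ v (by norm_num)]
  · have h6 : u ≤ 12 * w := by
      by_contra! h6
      exact h4 ⟨by linarith, h6.le⟩
    have k := key (3 * w / 20) (by linarith) (by linarith) (by linarith) (by linarith)
    refine ⟨3 * w / 20, by positivity, k, a, b, c + 1, by omega,
      { k with three_le := by omega, tight_top := ?_ }⟩
    rwa [show 20 * (3 * w / 20) / 3 = w by ring]

lemma SelfSim.step_aux (hQ : SelfSim Q) (n : ℕ) (hn : 1 ≤ n) : Step Q (125/128) n ∧
    (3 ≤ n → Step Q (125/512) n) ∧
    (4 ≤ n → ∃ l : ℝ, 0 < l ∧ ∃ a b c, a + b + c = n + 1 ∧ Balanced Q l a b c) := by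
  induction n using Nat.strong_induction_on with
  | _ n ih =>
    have h1 := hQ.tight_treeOne
    obtain ⟨h2, h2'⟩ := hQ.tight_treeTwo
    obtain ⟨h3, h3'⟩ := hQ.tight_treeThree
    obtain ⟨h4, h4'⟩ := hQ.tight_treeFour
    obtain ⟨h5, h5'⟩ := hQ.tight_treeFive
    rcases Nat.lt_or_ge 4 n with hlt | hle
    · obtain ⟨l, hl, a, b, c, hN, hB⟩ := (ih (n - 1) (by omega) (by omega)).2.2 (by omega)
      have := hB.one_le_left
      have := hB.one_le_right
      have := hB.three_le
      obtain ⟨m, hm, k, a', b', c', hN', k'⟩ := hB.exists_succ hQ hl.le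
        (ih a (by omega) (by omega)).1 (ih b (by omega) (by omega)).1
        ((ih c (by omega) (by omega)).2.1 (by omega))
      have hs : Step Q (125/512) n := by
        refine ⟨m, hm, ?_, ?_⟩
        · convert k.tight hQ using 1
          omega
        · convert k'.tight hQ using 1
          omega
      exact ⟨hs.mono hQ, fun _ => hs, fun _ => ⟨m, hm, a', b', c', by omega, k'⟩⟩
    · have hs : 3 ≤ n → Step Q (125/512) n := by
        intro h
        obtain rfl | rfl : n = 3 ∨ n = 4 := by omega
        · exact ⟨_, by norm_num, h4, h4'⟩
        · exact ⟨_, by norm_num, h5, h5'⟩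
      refine ⟨?_, hs, fun h => ⟨81/51200, by norm_num, 1, 1, 3, by omega,
        le_rfl, le_rfl, le_rfl, ?_, ?_, ?_⟩⟩
      · rcases Nat.lt_or_ge n 3 with h | h
        · obtain rfl | rfl : n = 1 ∨ n = 2 := by omega
          · exact ⟨_, by norm_num, h2, h2'⟩
          · exact ⟨_, by norm_num, h3, h3'⟩
        · exact (hs h).mono hQ
      · convert h1 using 1; norm_num
      · convert h1 using 1; norm_num
      · convert h4 using 1; norm_num

/-- The points of optimal sets are canonical, in the coordinates `(x₁, x₂ / √3)`. -/
theorem SelfSim.canon (hQ : SelfSim Q) {n : ℕ} {α : Set (ℝ × ℝ)} (h1 : 1 ≤ α.encard)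
    (hn : α.encard ≤ (n : ℕ∞)) (hα : distor Q α = qe Q n) {c : ℝ × ℝ} (hc : c ∈ α) :
    Canon c := by
  obtain ⟨l, hl, h, -⟩ := (hQ.step_aux n (by exact_mod_cast h1.trans hn)).1
  exact h.canon hQ hl.le h1 hn hα hc

end

/-- The coordinates `(x₁, x₂ / √3)`. -/
noncomputable def coord : ℝ × ℝ ≃ₜ ℝ × ℝ :=
  (Homeomorph.refl ℝ).prodCongr (Homeomorph.mulRight₀ (√3)⁻¹ (by positivity))

lemma coord_apply (x : ℝ × ℝ) : coord x = (x.1, x.2 / √3) := rfl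

lemma sqDist_eq_hd (x a : ℝ × ℝ) : sqDist x a = hd (coord x) (coord a) := by
  have h : √3 ^ 2 = 3 := Real.sq_sqrt (by norm_num)
  simp only [sqDist, hd, coord_apply, ← sub_div, div_pow, h]
  ring

lemma coord_Smap_zero (x : ℝ × ℝ) : coord (Smap 0 x) = T₁ (coord x) := by
  ext <;> simp [coord_apply, Smap, T₁]
  ring

lemma coord_Smap_one (x : ℝ × ℝ) : coord (Smap 1 x) = T₂ (coord x) := by
  ext <;> simp [coord_apply, Smap, T₂]
  ring

lemma coord_Smap_two (x : ℝ × ℝ) : coord (Smap 2 x) = T₃ (coord x) := by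
  ext <;> simp [coord_apply, Smap, T₃]
  field_simp

lemma continuous_Smap (i : Fin 3) : Continuous (Smap i) := by
  fin_cases i <;> simp only [Smap] <;> dsimp <;> fun_prop

lemma _root_.IsRMeasure.selfSim {P : Measure (ℝ × ℝ)} (hP : IsRMeasure P) :
    SelfSim (P.map coord) := by
  have hm : ∀ {T : ℝ × ℝ → ℝ × ℝ} (i : Fin 3), Continuous T →
      (∀ x, coord (Smap i x) = T (coord x)) →
      (P.map (Smap i)).map coord = (P.map coord).map T := by
    intro T i hT h
    rw [Measure.map_map coord.continuous.measurable (continuous_Smap i).measurable,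
      Measure.map_map hT.measurable coord.continuous.measurable]
    exact congrArg (fun g => P.map g) (funext h)
  have hc := coord.continuous.measurable
  unfold SelfSim
  rw [← hm 0 continuous_T₁ coord_Smap_zero, ← hm 1 continuous_T₂ coord_Smap_one,
    ← hm 2 continuous_T₃ coord_Smap_two]
  conv_lhs => rw [hP]
  simp only [Measure.map_add _ _ hc, Measure.map_smul]

lemma distortion_eq_distor (P : Measure (ℝ × ℝ)) (α : Set (ℝ × ℝ)) :
    distortion P α = distor (P.map coord) (coord '' α) := by
  rw [distor, coord.measurableEmbedding.integral_map]
  simp only [distortion, sqDist_eq_hd, image_image]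

lemma quantErr_eq_qe (P : Measure (ℝ × ℝ)) (n : ℕ) : quantErr P n = qe (P.map coord) n := by
  unfold quantErr qe
  congr 1
  ext v
  constructor
  · rintro ⟨α, h1, h2, rfl⟩
    refine ⟨coord '' α, ?_, ?_, distortion_eq_distor P α⟩ <;>
      rwa [coord.injective.encard_image]
  · rintro ⟨α, h1, h2, rfl⟩
    refine ⟨coord.symm '' α, ?_, ?_, ?_⟩
    · rwa [coord.symm.injective.encard_image]
    · rwa [coord.symm.injective.encard_image]
    · rw [distortion_eq_distor, image_image]
      simp

lemma Smap_aw (i : Fin 3) (ω : List (Fin 3)) : Smap i (aw ω) = aw (i :: ω) := rfl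

lemma Smap_a12 (i : Fin 3) (ω : List (Fin 3)) : Smap i (a12 ω) = a12 (i :: ω) := by
  simp only [a12, List.cons_append, ← Smap_aw]
  fin_cases i <;> ext <;> simp [Smap] <;> ring

lemma Canon.exists_word {x : ℝ × ℝ} (h : Canon x) :
    (∃ ω : List (Fin 3), x = coord (aw ω)) ∨ (∃ ω : List (Fin 3), x = coord (a12 ω)) := by
  induction h with
  | center =>
    refine .inl ⟨[], ?_⟩
    ext <;> simp [coord_apply, aw, Sw]
    field_simp
  | base =>
    refine .inr ⟨[], ?_⟩
    ext <;> simp [coord_apply, a12, aw, Sw, Smap] <;> field_simp <;> norm_num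
  | T₁ _ ih =>
    obtain ⟨ω, rfl⟩ | ⟨ω, rfl⟩ := ih
    · exact .inl ⟨0 :: ω, by rw [← Smap_aw, coord_Smap_zero]⟩
    · exact .inr ⟨0 :: ω, by rw [← Smap_a12, coord_Smap_zero]⟩
  | T₂ _ ih =>
    obtain ⟨ω, rfl⟩ | ⟨ω, rfl⟩ := ih
    · exact .inl ⟨1 :: ω, by rw [← Smap_aw, coord_Smap_one]⟩
    · exact .inr ⟨1 :: ω, by rw [← Smap_a12, coord_Smap_one]⟩
  | T₃ _ ih =>
    obtain ⟨ω, rfl⟩ | ⟨ω, rfl⟩ := ih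
    · exact .inl ⟨2 :: ω, by rw [← Smap_aw, coord_Smap_two]⟩
    · exact .inr ⟨2 :: ω, by rw [← Smap_a12, coord_Smap_two]⟩

end RTriangle

/-- For n ≥ 3, every point of an optimal set of n-means is of the form `a(ω)` or
`a(ω1, ω2)` for some word ω over {1,2,3}. -/
theorem stmt_14 (P : Measure (ℝ × ℝ)) [IsProbabilityMeasure P] (hP : IsRMeasure P)
    (n : ℕ) (hn : 3 ≤ n) (α : Set (ℝ × ℝ)) (hα : IsOptimalSet P n α)
    (c : ℝ × ℝ) (hc : c ∈ α) :
    (∃ ω : List (Fin 3), c = aw ω) ∨ (∃ ω : List (Fin 3), c = a12 ω) := by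
  obtain ⟨h1, hle, hopt⟩ := hα
  have : IsProbabilityMeasure (P.map RTriangle.coord) :=
    Measure.isProbabilityMeasure_map RTriangle.coord.continuous.aemeasurable
  rw [RTriangle.distortion_eq_distor, RTriangle.quantErr_eq_qe] at hopt
  rw [← RTriangle.coord.injective.encard_image] at h1 hle
  have h := (hP.selfSim.canon h1 hle hopt (mem_image_of_mem _ hc)).exists_word
  exact h.imp (fun ⟨ω, e⟩ => ⟨ω, RTriangle.coord.injective e⟩)
    fun ⟨ω, e⟩ => ⟨ω, RTriangle.coord.injective e⟩
end
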